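/- arXiv:0909.3202 — 2 statements merged into one kernel-verified Lean document; each statement's English description precedes it below -/
import Mathlib

section
/- Suppose the ℝ-building (Λ,F) is contained in a metrically complete ℝ-building (Λ',F') of the same type, let Λ̄ be the closure of Λ in Λ', and let α ∈ Λ̄ \ Λ. Let C_α and C'_α be sectors of Λ' based at α whose directions C_∞ and C'_∞ are chambers at infinity of Λ, and let w ∈ W̄ be the Weyl distance from the germ [C]_α to the germ [C']_α. Then there exists a sector C''_α of Λ' based at α with the same germ at α as C'_α, whose direction C''_∞ is a chamber at infinity of Λ, such that the Weyl distance from C_∞ to C''_∞ equals w. -/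
open Set

noncomputable section

/-- The model space `𝔸`: Euclidean `n`-space. -/
abbrev ModelSpace (n : ℕ) : Type := EuclideanSpace ℝ (Fin n)

/-- A linear reflection of the model space: an involutive isometry, different from the
identity, whose fixed-point set is a linear hyperplane (the kernel of a nonzero linear
functional). -/
def IsLinearReflection {n : ℕ} (s : ModelSpace n ≃ᵢ ModelSpace n) : Prop :=
  s * s = 1 ∧ s ≠ 1 ∧
    ∃ p : ModelSpace n →ₗ[ℝ] ℝ, p ≠ 0 ∧ {x | s x = x} = {x | p x = 0}

/-- A spherical Coxeter system of rank `n`, realized as a finite reflection group acting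
on the model space `ℝⁿ`: a finite set `S` of linear reflections generating a finite
group `W̄`. -/
structure SphericalCoxeterSystem (n : ℕ) where
  S : Set (ModelSpace n ≃ᵢ ModelSpace n)
  finiteS : S.Finite
  refl : ∀ s ∈ S, IsLinearReflection s
  finiteW : Finite ↥(Subgroup.closure S)

namespace SphericalCoxeterSystem

variable {n : ℕ}

/-- The finite reflection group `W̄` generated by `S`. -/
def Wbar (cs : SphericalCoxeterSystem n) : Subgroup (ModelSpace n ≃ᵢ ModelSpace n) :=
  Subgroup.closure cs.S

/-- A translation of the model space. -/
def IsTranslation (t : ModelSpace n ≃ᵢ ModelSpace n) : Prop :=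
  ∃ v : ModelSpace n, ∀ x, t x = x + v

/-- The group `W` of affine transformations generated by `W̄` and all translations. -/
def W (cs : SphericalCoxeterSystem n) : Subgroup (ModelSpace n ≃ᵢ ModelSpace n) :=
  Subgroup.closure (cs.S ∪ {t | IsTranslation t})

/-- An affine reflection: a `W`-conjugate of a generator in `S`. -/
def IsAffineReflection (cs : SphericalCoxeterSystem n)
    (r : ModelSpace n ≃ᵢ ModelSpace n) : Prop :=
  ∃ s ∈ cs.S, ∃ w ∈ cs.W, r = w * s * w⁻¹

/-- A wall of the model space: the fixed-point set of an affine reflection. -/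
def IsModelWall (cs : SphericalCoxeterSystem n) (M : Set (ModelSpace n)) : Prop :=
  ∃ r, cs.IsAffineReflection r ∧ M = {x | r x = x}

/-- A half-apartment of the model space: a closed half-space `H` bounded by the
wall `M` (fixed-point set of the affine reflection `r`). -/
def IsModelHalf (cs : SphericalCoxeterSystem n) (M H : Set (ModelSpace n)) : Prop :=
  ∃ r, cs.IsAffineReflection r ∧ M = {x | r x = x} ∧
    IsClosed H ∧ Convex ℝ H ∧ H ∪ (⇑r '' H) = univ ∧ H ∩ (⇑r '' H) = M

/-- A sector-face of the model space based at `x`: a closed cell of the arrangement of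
all walls through `x` (for each wall through `x` one chooses either the wall itself or
one of its two half-apartments, and takes the intersection of the choices). -/
def IsModelSectorFace (cs : SphericalCoxeterSystem n) (x : ModelSpace n)
    (F : Set (ModelSpace n)) : Prop :=
  F.Nonempty ∧ ∃ σ : Set (ModelSpace n) → Set (ModelSpace n),
    (∀ M, cs.IsModelWall M → x ∈ M → (σ M = M ∨ cs.IsModelHalf M (σ M))) ∧
    F = ⋂ M ∈ {M | cs.IsModelWall M ∧ x ∈ M}, σ M

/-- A sector of the model space based at `x`: a maximal sector-face based at `x`. -/
def IsModelSector (cs : SphericalCoxeterSystem n) (x : ModelSpace n)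
    (F : Set (ModelSpace n)) : Prop :=
  cs.IsModelSectorFace x F ∧ ∀ F', cs.IsModelSectorFace x F' → F ⊆ F' → F' = F

/-- A sector-panel of the model space based at `x`: a sector-face of codimension one. -/
def IsModelSectorPanel (cs : SphericalCoxeterSystem n) (x : ModelSpace n)
    (F : Set (ModelSpace n)) : Prop :=
  cs.IsModelSectorFace x F ∧ Module.finrank ℝ (affineSpan ℝ F).direction = n - 1

/-- The word length on `W̄` with respect to the generating set `S`. -/
def wordLength (cs : SphericalCoxeterSystem n) (w : ModelSpace n ≃ᵢ ModelSpace n) : ℕ :=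
  sInf {k | ∃ l : List (ModelSpace n ≃ᵢ ModelSpace n),
    l.length = k ∧ (∀ s ∈ l, s ∈ cs.S) ∧ l.prod = w}

/-- The longest element of `W̄`. -/
def IsLongest (cs : SphericalCoxeterSystem n) (w : ModelSpace n ≃ᵢ ModelSpace n) : Prop :=
  w ∈ cs.Wbar ∧ ∀ v ∈ cs.Wbar, cs.wordLength v ≤ cs.wordLength w

end SphericalCoxeterSystem

section Building

variable {n : ℕ} {X : Type*} [MetricSpace X]

/-- Two subsets of a metric space are parallel if their Hausdorff distance is finite. -/
def Par (S T : Set X) : Prop := EMetric.hausdorffEdist S T ≠ ⊤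

/-- Two sets locally coincide at `α` (have the same germ at `α`) if their intersection
is a neighbourhood of `α` in both of them. -/
def LocCoin (α : X) (F F' : Set X) : Prop :=
  F ∩ F' ∈ nhdsWithin α F ∧ F ∩ F' ∈ nhdsWithin α F'

variable (cs : SphericalCoxeterSystem n)

/-- An apartment: the image of a chart. -/
def IsApartment (Fc : Set (ModelSpace n → X)) (A : Set X) : Prop :=
  ∃ f ∈ Fc, A = range f

/-- A sector-face based at `α` : the image under a chart of a sector-face of the model
space, with base point mapped to `α`. -/
def IsSectorFaceAt (Fc : Set (ModelSpace n → X)) (α : X) (F : Set X) : Prop :=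
  ∃ f ∈ Fc, ∃ x s, cs.IsModelSectorFace x s ∧ f x = α ∧ F = f '' s

/-- A sector based at `α`. -/
def IsSectorAt (Fc : Set (ModelSpace n → X)) (α : X) (F : Set X) : Prop :=
  ∃ f ∈ Fc, ∃ x s, cs.IsModelSector x s ∧ f x = α ∧ F = f '' s

/-- A sector-panel based at `α`. -/
def IsSectorPanelAt (Fc : Set (ModelSpace n → X)) (α : X) (F : Set X) : Prop :=
  ∃ f ∈ Fc, ∃ x s, cs.IsModelSectorPanel x s ∧ f x = α ∧ F = f '' s

/-- A sector-face. -/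
def IsSectorFace (Fc : Set (ModelSpace n → X)) (F : Set X) : Prop :=
  ∃ α, IsSectorFaceAt cs Fc α F

/-- A sector. -/
def IsSector (Fc : Set (ModelSpace n → X)) (F : Set X) : Prop :=
  ∃ α, IsSectorAt cs Fc α F

/-- A sector-panel. -/
def IsSectorPanel (Fc : Set (ModelSpace n → X)) (F : Set X) : Prop :=
  ∃ α, IsSectorPanelAt cs Fc α F

/-- A wall: the image of a wall of the model space under a chart. -/
def IsWall (Fc : Set (ModelSpace n → X)) (M : Set X) : Prop :=
  ∃ f ∈ Fc, ∃ m, cs.IsModelWall m ∧ M = f '' m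

/-- A half-apartment: the image of a half-apartment of the model space under a chart. -/
def IsHalfApartment (Fc : Set (ModelSpace n → X)) (H : Set X) : Prop :=
  ∃ f ∈ Fc, ∃ m h, cs.IsModelHalf m h ∧ H = f '' h

/-- An ℝ-building of type `(W̄,S)` with set of points `Λ` inside the ambient metric
space `X` (taking `Λ` a subset of an ambient metric space makes it possible to speak of
one ℝ-building being contained in another): a set of isometric charts from the model
space satisfying the axioms (A1)–(A5). -/
structure RBuilding (cs : SphericalCoxeterSystem n) (X : Type*) [MetricSpace X]
    (Λ : Set X) : Type _ where
  charts : Set (ModelSpace n → X)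
  isom : ∀ f ∈ charts, Isometry f
  into : ∀ f ∈ charts, range f ⊆ Λ
  A1 : ∀ f ∈ charts, ∀ w ∈ cs.W, (f ∘ ⇑w) ∈ charts
  A2 : ∀ f ∈ charts, ∀ g ∈ charts,
        IsClosed {x | f x ∈ range g} ∧ Convex ℝ {x | f x ∈ range g} ∧
        ∃ w ∈ cs.W, ∀ x, f x ∈ range g → f x = g (w x)
  A3 : ∀ p ∈ Λ, ∀ q ∈ Λ, ∃ f ∈ charts, p ∈ range f ∧ q ∈ range f
  A4 : ∀ S₁ S₂, IsSector cs charts S₁ → IsSector cs charts S₂ →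
        ∃ T₁ T₂ f, f ∈ charts ∧ IsSector cs charts T₁ ∧ IsSector cs charts T₂ ∧
          T₁ ⊆ S₁ ∧ T₂ ⊆ S₂ ∧ T₁ ⊆ range f ∧ T₂ ⊆ range f
  A5 : ∀ f₁ ∈ charts, ∀ f₂ ∈ charts, ∀ f₃ ∈ charts,
        IsHalfApartment cs charts (range f₁ ∩ range f₂) →
        IsHalfApartment cs charts (range f₂ ∩ range f₃) →
        IsHalfApartment cs charts (range f₁ ∩ range f₃) →
        (range f₁ ∩ range f₂ ∩ range f₃).Nonempty

/-- The Weyl distance, inside the apartment given by the chart `f`, from the sector `S`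
to the sector `S'` (both contained in that apartment): the element `w ∈ W̄` mapping the
sector of the model space based at the origin parallel to `f⁻¹(S)` to the one parallel
to `f⁻¹(S')`. -/
def WeylDistIn (f : ModelSpace n → X) (S S' : Set X)
    (w : ModelSpace n ≃ᵢ ModelSpace n) : Prop :=
  w ∈ cs.Wbar ∧ ∃ s s', cs.IsModelSector 0 s ∧ cs.IsModelSector 0 s' ∧
    Par (f '' s) S ∧ Par (f '' s') S' ∧ ⇑w '' s = s'

/-- `w` is the Weyl distance from the germ at `α` of the sector `S` to the germ at `α`
of the sector `S'` (both based at `α`): computed via sectors based at `α` with the same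
germs lying in a common apartment. -/
def GermWeylDist (Fc : Set (ModelSpace n → X)) (α : X) (S S' : Set X)
    (w : ModelSpace n ≃ᵢ ModelSpace n) : Prop :=
  ∃ f ∈ Fc, ∃ T T', IsSectorAt cs Fc α T ∧ IsSectorAt cs Fc α T' ∧
    T ⊆ range f ∧ T' ⊆ range f ∧ LocCoin α S T ∧ LocCoin α S' T' ∧
    WeylDistIn cs f T T' w

/-- `w` is the Weyl distance between the chambers at infinity represented by the
sectors `S` and `S'`: computed via parallel sectors lying in a common apartment. -/
def ChamberWeylDist (Fc : Set (ModelSpace n → X)) (S S' : Set X)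
    (w : ModelSpace n ≃ᵢ ModelSpace n) : Prop :=
  ∃ f ∈ Fc, ∃ T T', IsSector cs Fc T ∧ IsSector cs Fc T' ∧
    T ⊆ range f ∧ T' ⊆ range f ∧ Par T S ∧ Par T' S' ∧ WeylDistIn cs f T T' w

/-- The germs at `α` of two sectors based at `α` are opposite if their Weyl distance is
the longest element of `W̄`. -/
def OppositeGerms (Fc : Set (ModelSpace n → X)) (α : X) (S S' : Set X) : Prop :=
  ∃ w, GermWeylDist cs Fc α S S' w ∧ cs.IsLongest w

/-- Two chambers at infinity (represented by the sectors `C`, `D`) are adjacent if they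
are distinct and their Weyl distance lies in `S`. -/
def AdjacentChambers (Fc : Set (ModelSpace n → X)) (C D : Set X) : Prop :=
  ¬ Par C D ∧ ∃ s ∈ cs.S, ChamberWeylDist cs Fc C D s

/-- Two sector-panels are asymptotic if they contain a common subset which is itself a
sector-panel. -/
def Asymptotic (Fc : Set (ModelSpace n → X)) (P P' : Set X) : Prop :=
  ∃ Q, IsSectorPanel cs Fc Q ∧ Q ⊆ P ∧ Q ⊆ P'

/-- An automorphism of an ℝ-building: an isometry `g` of `Λ` with `g ∘ f` a chart for
every chart `f`. -/
def RBuilding.IsAuto {Λ : Set X} (B : RBuilding cs X Λ) (g : ↥Λ ≃ᵢ ↥Λ) : Prop :=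
  ∀ f (hf : f ∈ B.charts),
    (fun a : ModelSpace n =>
      ((g ⟨f a, B.into f hf (mem_range_self a)⟩ : ↥Λ) : X)) ∈ B.charts

end Building

section CAT0

/-- `G` is a geodesic segment from `x` to `y`: an isometric image of a closed real
interval with endpoints `x` and `y`. -/
def IsGeodesicSegment {Y : Type*} [MetricSpace Y] (x y : Y) (G : Set Y) : Prop :=
  ∃ (a b : ℝ) (γ : ℝ → Y), a ≤ b ∧ γ a = x ∧ γ b = y ∧
    (∀ s ∈ Set.Icc a b, ∀ t ∈ Set.Icc a b, dist (γ s) (γ t) = |s - t|) ∧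
    G = γ '' Set.Icc a b

/-- A CAT(0) space: a geodesic metric space in which every geodesic triangle satisfies
the CAT(0) comparison inequality with respect to comparison triangles in the Euclidean
plane. -/
def IsCAT0Space (Y : Type*) [MetricSpace Y] : Prop :=
  (∀ x y : Y, ∃ G, IsGeodesicSegment x y G) ∧
  ∀ (x y z : Y) (G : Set Y), IsGeodesicSegment x y G → ∀ a ∈ G,
    ∀ x' y' z' : EuclideanSpace ℝ (Fin 2),
      dist x' y' = dist x y → dist y' z' = dist y z → dist x' z' = dist x z →
      ∀ a' ∈ segment ℝ x' y', dist x' a' = dist x a → dist z a ≤ dist z' a'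

end CAT0

open scoped RealInnerProductSpace

namespace SphericalCoxeterSystem

variable {n : ℕ} (cs : SphericalCoxeterSystem n)

@[simp]
theorem apply_inv_apply (w : ModelSpace n ≃ᵢ ModelSpace n) (x : ModelSpace n) :
    w (w⁻¹ x) = x := w.apply_symm_apply x

@[simp]
theorem inv_apply_apply (w : ModelSpace n ≃ᵢ ModelSpace n) (x : ModelSpace n) :
    w⁻¹ (w x) = x := w.symm_apply_apply x

/-- `r` is the orthogonal reflection in the hyperplane normal to the unit vector `α`. -/
def IsReflectionIn (r : ModelSpace n ≃ᵢ ModelSpace n) (α : ModelSpace n) : Prop :=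
  ‖α‖ = 1 ∧ ∀ x, r x = x - (2 * ⟪α, x⟫) • α

theorem IsReflectionIn.apply_apply {r : ModelSpace n ≃ᵢ ModelSpace n} {α : ModelSpace n}
    (h : IsReflectionIn r α) (x : ModelSpace n) : r (r x) = x := by
  rw [h.2 (r x), h.2 x, inner_sub_right, inner_smul_right, real_inner_self_eq_norm_sq, h.1]
  module

theorem IsReflectionIn.mul_self {r : ModelSpace n ≃ᵢ ModelSpace n} {α : ModelSpace n}
    (h : IsReflectionIn r α) : r * r = 1 := by
  ext1 x
  exact h.apply_apply x

theorem IsReflectionIn.inner_comm {r : ModelSpace n ≃ᵢ ModelSpace n} {α : ModelSpace n}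
    (h : IsReflectionIn r α) (x y : ModelSpace n) : ⟪r x, y⟫ = ⟪x, r y⟫ := by
  rw [h.2, h.2, inner_sub_left, inner_sub_right, inner_smul_left, inner_smul_right,
    real_inner_comm x α]
  simp only [conj_trivial]
  ring

theorem IsReflectionIn.apply_eq_self_iff {r : ModelSpace n ≃ᵢ ModelSpace n}
    {α : ModelSpace n} (h : IsReflectionIn r α) (x : ModelSpace n) :
    r x = x ↔ ⟪α, x⟫ = 0 := by
  have hα : α ≠ 0 := by
    rintro rfl
    simpa using h.1
  rw [h.2, sub_eq_self, smul_eq_zero]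
  simp [hα]

theorem eq_or_eq_neg_of_forall_inner {α β : ModelSpace n} (hα : ‖α‖ = 1) (hβ : ‖β‖ = 1)
    (h : ∀ x, ⟪α, x⟫ = 0 → ⟪β, x⟫ = 0) : β = α ∨ β = -α := by
  have hαα : ⟪α, α⟫ = 1 := by rw [real_inner_self_eq_norm_sq, hα]; norm_num
  have hββ : ⟪β, β⟫ = 1 := by rw [real_inner_self_eq_norm_sq, hβ]; norm_num
  have h1 := h (β - ⟪α, β⟫ • α) (by rw [inner_sub_right, inner_smul_right, hαα]; ring)
  rw [inner_sub_right, inner_smul_right, hββ, real_inner_comm α β] at h1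
  have h4 : (⟪α, β⟫ - 1) * (⟪α, β⟫ + 1) = 0 := by nlinarith
  rcases (mul_eq_zero.mp h4).imp sub_eq_zero.mp eq_neg_of_add_eq_zero_left with h2 | h2
  · exact Or.inl ((inner_eq_one_iff_of_norm_eq_one hα hβ).mp h2).symm
  · right
    have h3 : ⟪α, -β⟫ = 1 := by rw [inner_neg_right, h2]; norm_num
    rw [(inner_eq_one_iff_of_norm_eq_one hα (by rwa [norm_neg])).mp h3, neg_neg]

theorem IsReflectionIn.eq_or_eq_neg {r : ModelSpace n ≃ᵢ ModelSpace n} {α β : ModelSpace n}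
    (h : IsReflectionIn r α) (h' : IsReflectionIn r β) : β = α ∨ β = -α :=
  eq_or_eq_neg_of_forall_inner h.1 h'.1 fun x hx =>
    (h'.apply_eq_self_iff x).mp ((h.apply_eq_self_iff x).mpr hx)

theorem _root_.IsLinearReflection.exists_isReflectionIn {s : ModelSpace n ≃ᵢ ModelSpace n}
    (h : IsLinearReflection s) : ∃ α, IsReflectionIn s α := by
  obtain ⟨hss, -, p, hp, hfix⟩ := h
  have hs0 : s 0 = 0 := by
    have : (0 : ModelSpace n) ∈ {x | p x = 0} := by simp
    rwa [← hfix] at this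
  set L := s.toRealLinearIsometryEquivOfMapZero hs0 with hL
  have hsL : ∀ x, s x = L x := fun x => rfl
  have hLL : ∀ x, L (L x) = x := fun x => by
    have := congrArg (fun t : ModelSpace n ≃ᵢ ModelSpace n => t x) hss
    exact this
  have hfix' : ∀ x, L x = x ↔ p x = 0 := fun x => by
    rw [← hsL]
    exact Set.ext_iff.mp hfix x
  set a := (InnerProductSpace.toDual ℝ (ModelSpace n)).symm p.toContinuousLinearMap with ha
  have hpa : ∀ x, p x = ⟪a, x⟫ := fun x => by
    rw [ha, InnerProductSpace.toDual_symm_apply]; rfl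
  have ha0 : a ≠ 0 := by
    intro h0
    apply hp
    ext x
    simp [hpa, h0]
  have haa : 0 < ⟪a, a⟫ := real_inner_self_pos.mpr ha0
  have hperp : ∀ x y, ⟪a, y⟫ = 0 → ⟪x - L x, y⟫ = 0 := fun x y hy => by
    have hy' : L y = y := (hfix' y).mpr (by rw [hpa, hy])
    rw [inner_sub_left, ← hy', L.inner_map_map, hy', sub_self]
  have hform : ∀ x, ∃ c : ℝ, x - L x = c • a := fun x => by
    refine ⟨⟪a, x - L x⟫ / ⟪a, a⟫, ?_⟩
    rw [← sub_eq_zero, ← inner_self_eq_zero (𝕜 := ℝ)]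
    set y := x - L x - (⟪a, x - L x⟫ / ⟪a, a⟫) • a with hy
    have hay : ⟪a, y⟫ = 0 := by
      rw [hy, inner_sub_right, inner_smul_right]; field_simp; ring
    conv_lhs => rw [hy]
    rw [inner_sub_left, hperp x y hay, inner_smul_left, hay]; simp
  have hsum : ∀ x, ⟪a, x + L x⟫ = 0 := fun x => by
    rw [← hpa, ← hfix', map_add, hLL, add_comm]
  refine ⟨‖a‖⁻¹ • a, ?_, fun x => ?_⟩
  · rw [norm_smul, norm_inv, norm_norm, inv_mul_cancel₀ (norm_ne_zero_iff.mpr ha0)]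
  · obtain ⟨c, hc⟩ := hform x
    have h1 := hsum x
    have h2 : L x = x - c • a := by rw [← hc]; abel
    rw [h2, inner_add_right, inner_sub_right, inner_smul_right] at h1
    have hna : ‖a‖ ≠ 0 := norm_ne_zero_iff.mpr ha0
    rw [real_inner_self_eq_norm_sq] at h1
    have h3 : c = 2 * ⟪a, x⟫ / ‖a‖ ^ 2 := by field_simp; linarith
    rw [hsL, h2, h3, inner_smul_left, smul_smul]
    congr 2
    simp only [conj_trivial]
    field_simp

theorem exists_linear_of_mem_Wbar {w : ModelSpace n ≃ᵢ ModelSpace n} (hw : w ∈ cs.Wbar) :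
    ∃ L : ModelSpace n ≃ₗᵢ[ℝ] ModelSpace n, ∀ x, w x = L x := by
  have h0 : w 0 = 0 := by
    induction hw using Subgroup.closure_induction with
    | mem s hs =>
      obtain ⟨α, hα⟩ := (cs.refl s hs).exists_isReflectionIn
      rw [hα.2]; simp
    | one => rfl
    | mul x y _ _ hx hy => rw [IsometryEquiv.mul_apply, hy, hx]
    | inv x _ hx => exact x.injective (by rw [apply_inv_apply, hx])
  exact ⟨w.toRealLinearIsometryEquivOfMapZero h0, fun x => rfl⟩

section

variable {cs} {w : ModelSpace n ≃ᵢ ModelSpace n}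

theorem Wbar_map_zero (hw : w ∈ cs.Wbar) : w 0 = 0 := by
  obtain ⟨L, hL⟩ := cs.exists_linear_of_mem_Wbar hw
  simp [hL]

theorem Wbar_map_add (hw : w ∈ cs.Wbar) (x y : ModelSpace n) : w (x + y) = w x + w y := by
  obtain ⟨L, hL⟩ := cs.exists_linear_of_mem_Wbar hw
  simp [hL]

theorem Wbar_map_sub (hw : w ∈ cs.Wbar) (x y : ModelSpace n) : w (x - y) = w x - w y := by
  obtain ⟨L, hL⟩ := cs.exists_linear_of_mem_Wbar hw
  simp [hL]

theorem Wbar_map_neg (hw : w ∈ cs.Wbar) (x : ModelSpace n) : w (-x) = -w x := by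
  obtain ⟨L, hL⟩ := cs.exists_linear_of_mem_Wbar hw
  simp [hL]

theorem Wbar_map_smul (hw : w ∈ cs.Wbar) (c : ℝ) (x : ModelSpace n) : w (c • x) = c • w x := by
  obtain ⟨L, hL⟩ := cs.exists_linear_of_mem_Wbar hw
  simp [hL]

theorem Wbar_norm_map (hw : w ∈ cs.Wbar) (x : ModelSpace n) : ‖w x‖ = ‖x‖ := by
  obtain ⟨L, hL⟩ := cs.exists_linear_of_mem_Wbar hw
  simp [hL]

theorem Wbar_inner_map (hw : w ∈ cs.Wbar) (x y : ModelSpace n) : ⟪w x, w y⟫ = ⟪x, y⟫ := by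
  obtain ⟨L, hL⟩ := cs.exists_linear_of_mem_Wbar hw
  simp [hL]

theorem Wbar_inner_left (hw : w ∈ cs.Wbar) (x y : ModelSpace n) : ⟪w x, y⟫ = ⟪x, w⁻¹ y⟫ := by
  rw [← Wbar_inner_map hw x, apply_inv_apply]

theorem Wbar_inner_inv_left (hw : w ∈ cs.Wbar) (x y : ModelSpace n) : ⟪w⁻¹ x, y⟫ = ⟪x, w y⟫ := by
  rw [Wbar_inner_left (inv_mem hw), inv_inv]

end

theorem IsReflectionIn.conj {s w : ModelSpace n ≃ᵢ ModelSpace n} {α : ModelSpace n}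
    (h : IsReflectionIn s α) (hw : w ∈ cs.Wbar) : IsReflectionIn (w * s * w⁻¹) (w α) := by
  refine ⟨by rw [Wbar_norm_map hw, h.1], fun x => ?_⟩
  rw [IsometryEquiv.mul_apply, IsometryEquiv.mul_apply, h.2, Wbar_map_sub hw, Wbar_map_smul hw,
    apply_inv_apply, Wbar_inner_left hw]

/-- The unit normals of the walls through the origin. -/
def roots : Set (ModelSpace n) :=
  {α | ∃ s ∈ cs.S, ∃ w ∈ cs.Wbar, IsReflectionIn (w * s * w⁻¹) α}

variable {cs}

theorem norm_of_mem_roots {α : ModelSpace n} (h : α ∈ cs.roots) : ‖α‖ = 1 := by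
  obtain ⟨_, _, _, _, h⟩ := h
  exact h.1

theorem inner_self_of_mem_roots {α : ModelSpace n} (h : α ∈ cs.roots) : ⟪α, α⟫ = 1 := by
  rw [real_inner_self_eq_norm_sq, norm_of_mem_roots h]; norm_num

theorem exists_reflection_of_mem_roots {α : ModelSpace n} (h : α ∈ cs.roots) :
    ∃ r ∈ cs.Wbar, IsReflectionIn r α := by
  obtain ⟨s, hs, w, hw, h⟩ := h
  exact ⟨_, mul_mem (mul_mem hw (Subgroup.subset_closure hs)) (inv_mem hw), h⟩

theorem neg_mem_roots {α : ModelSpace n} (h : α ∈ cs.roots) : -α ∈ cs.roots := by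
  obtain ⟨s, hs, w, hw, h⟩ := h
  refine ⟨s, hs, w, hw, by rw [norm_neg, h.1], fun x => ?_⟩
  rw [h.2, inner_neg_left]
  module

theorem map_mem_roots {α : ModelSpace n} (h : α ∈ cs.roots) {w : ModelSpace n ≃ᵢ ModelSpace n}
    (hw : w ∈ cs.Wbar) : w α ∈ cs.roots := by
  obtain ⟨s, hs, u, hu, h⟩ := h
  refine ⟨s, hs, w * u, mul_mem hw hu, ?_⟩
  have := h.conj cs hw
  rwa [show w * u * s * (w * u)⁻¹ = w * (u * s * u⁻¹) * w⁻¹ by group]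

variable (cs)

theorem finite_roots : cs.roots.Finite := by
  have : Finite cs.Wbar := cs.finiteW
  have hsub : cs.roots ⊆ ⋃ r : cs.Wbar, {α | IsReflectionIn (r : ModelSpace n ≃ᵢ ModelSpace n) α} := by
    intro α hα
    obtain ⟨r, hr, h⟩ := exists_reflection_of_mem_roots hα
    exact mem_iUnion.mpr ⟨⟨r, hr⟩, h⟩
  refine (finite_iUnion fun r => ?_).subset hsub
  by_cases h : ∃ α, IsReflectionIn (r : ModelSpace n ≃ᵢ ModelSpace n) α
  · obtain ⟨α, hα⟩ := h
    exact (Set.toFinite {α, -α}).subset fun β hβ => hα.eq_or_eq_neg hβ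
  · convert Set.finite_empty
    ext α
    simp only [mem_ofPred_eq, mem_empty_iff_false, iff_false]
    exact fun h' => h ⟨α, h'⟩

/-- A vector lying on no wall through the origin. -/
def Regular (v : ModelSpace n) : Prop := ∀ α ∈ cs.roots, ⟪α, v⟫ ≠ 0

/-- The closed chamber, based at the origin, of a regular vector. -/
def chamber (v : ModelSpace n) : Set (ModelSpace n) :=
  {y | ∀ α ∈ cs.roots, 0 < ⟪α, v⟫ → 0 ≤ ⟪α, y⟫}

theorem exists_regular : ∃ v, cs.Regular v := by
  have : Finite cs.roots := cs.finite_roots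
  obtain ⟨v, hv⟩ := Module.Dual.exists_forall_ne_zero_of_forall_exists
    (fun α : cs.roots => (innerSL ℝ (α : ModelSpace n)).toLinearMap)
    (fun α => ⟨α, by simp [norm_of_mem_roots α.2]⟩)
  exact ⟨v, fun α hα => by simpa using hv ⟨α, hα⟩⟩

/-- Every element of `W` is an element of `W̄` followed by a translation. -/
theorem exists_of_mem_W {w : ModelSpace n ≃ᵢ ModelSpace n} (hw : w ∈ cs.W) :
    ∃ u ∈ cs.Wbar, ∃ b, ∀ x, w x = u x + b := by
  induction hw using Subgroup.closure_induction with
  | mem s hs =>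
    rcases hs with hs | ⟨v, hv⟩
    · exact ⟨s, Subgroup.subset_closure hs, 0, fun x => by simp⟩
    · exact ⟨1, one_mem _, v, hv⟩
  | one => exact ⟨1, one_mem _, 0, fun x => by simp⟩
  | mul x y _ _ hx hy =>
    obtain ⟨u, hu, b, h⟩ := hx
    obtain ⟨u', hu', b', h'⟩ := hy
    refine ⟨u * u', mul_mem hu hu', u b' + b, fun z => ?_⟩
    rw [IsometryEquiv.mul_apply, h, h', Wbar_map_add hu, IsometryEquiv.mul_apply, add_assoc]
  | inv x _ hx =>
    obtain ⟨u, hu, b, h⟩ := hx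
    refine ⟨u⁻¹, inv_mem hu, -(u⁻¹ b), fun z => ?_⟩
    apply x.injective
    rw [apply_inv_apply, h, ← sub_eq_add_neg, Wbar_map_sub hu, apply_inv_apply, apply_inv_apply,
      sub_add_cancel]

theorem addRight_mem_W (b : ModelSpace n) : IsometryEquiv.addRight b ∈ cs.W :=
  Subgroup.subset_closure (Or.inr ⟨b, fun _ => rfl⟩)

theorem mem_W_of_mem_Wbar {w : ModelSpace n ≃ᵢ ModelSpace n} (hw : w ∈ cs.Wbar) : w ∈ cs.W :=
  Subgroup.closure_mono subset_union_left hw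

variable {cs}

theorem IsAffineReflection.exists_root {r : ModelSpace n ≃ᵢ ModelSpace n}
    (hr : cs.IsAffineReflection r) {x : ModelSpace n} (hx : r x = x) :
    ∃ α ∈ cs.roots, ∀ y, r y = y - (2 * ⟪α, y - x⟫) • α := by
  obtain ⟨s, hs, w, hw, rfl⟩ := hr
  obtain ⟨u, hu, b, h⟩ := cs.exists_of_mem_W hw
  obtain ⟨α, hα⟩ := (cs.refl s hs).exists_isReflectionIn
  have hαu := hα.conj cs hu
  refine ⟨u α, ⟨s, hs, u, hu, hαu⟩, fun y => ?_⟩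
  have hsW : s ∈ cs.Wbar := Subgroup.subset_closure hs
  have key : (w * s * w⁻¹) y - (w * s * w⁻¹) x = (u * s * u⁻¹) (y - x) := by
    simp only [IsometryEquiv.mul_apply]
    rw [h, h, add_sub_add_right_eq_sub, ← Wbar_map_sub hu, ← Wbar_map_sub hsW]
    congr 2
    have e : ∀ z, w⁻¹ z = u⁻¹ (z - b) := fun z => by
      apply w.injective
      rw [apply_inv_apply, h, apply_inv_apply, sub_add_cancel]
    rw [e, e, ← Wbar_map_sub (inv_mem hu), sub_sub_sub_cancel_right]
  rw [hx, hαu.2, sub_eq_iff_eq_add] at key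
  rw [key]
  abel

theorem exists_isAffineReflection {α : ModelSpace n} (hα : α ∈ cs.roots) (x : ModelSpace n) :
    ∃ r, cs.IsAffineReflection r ∧ ∀ y, r y = y - (2 * ⟪α, y - x⟫) • α := by
  obtain ⟨s, hs, w, hw, h⟩ := hα
  have hτ := cs.addRight_mem_W x
  refine ⟨_, ⟨s, hs, IsometryEquiv.addRight x * w, mul_mem hτ (cs.mem_W_of_mem_Wbar hw), rfl⟩,
    fun y => ?_⟩
  have : ∀ z, (IsometryEquiv.addRight x)⁻¹ z = z - x := fun z => by
    apply (IsometryEquiv.addRight x).injective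
    rw [apply_inv_apply]; simp
  have e := h.2 (y - x)
  simp only [IsometryEquiv.mul_apply, mul_inv_rev, this] at e ⊢
  rw [IsometryEquiv.addRight_apply, e]
  abel

theorem fixed_iff {α : ModelSpace n} (hα : α ∈ cs.roots) (x y : ModelSpace n) :
    y - (2 * ⟪α, y - x⟫) • α = y ↔ ⟪α, y - x⟫ = 0 := by
  have : α ≠ 0 := by
    rintro rfl
    simpa using norm_of_mem_roots hα
  rw [sub_eq_self, smul_eq_zero]
  simp [this]

theorem isModelWall_and_mem_iff {M : Set (ModelSpace n)} {x : ModelSpace n} :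
    cs.IsModelWall M ∧ x ∈ M ↔ ∃ α ∈ cs.roots, M = {y | ⟪α, y - x⟫ = 0} := by
  constructor
  · rintro ⟨⟨r, hr, rfl⟩, hx⟩
    obtain ⟨α, hα, h⟩ := hr.exists_root hx
    refine ⟨α, hα, ?_⟩
    ext y
    rw [mem_ofPred_eq, mem_ofPred_eq, h, fixed_iff hα]
  · rintro ⟨α, hα, rfl⟩
    refine ⟨?_, by simp⟩
    obtain ⟨r, hr, h⟩ := exists_isAffineReflection hα x
    refine ⟨r, hr, ?_⟩
    ext y
    rw [mem_ofPred_eq, mem_ofPred_eq, h, fixed_iff hα]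

theorem inner_affine_reflection {α : ModelSpace n} (hα : α ∈ cs.roots) (x y : ModelSpace n) :
    ⟪α, y - (2 * ⟪α, y - x⟫) • α - x⟫ = -⟪α, y - x⟫ := by
  rw [sub_right_comm, inner_sub_right _ (y - x), inner_smul_right, inner_self_of_mem_roots hα]
  ring

theorem isModelHalf_of_root {α : ModelSpace n} (hα : α ∈ cs.roots) (x : ModelSpace n) :
    cs.IsModelHalf {y | ⟪α, y - x⟫ = 0} {y | 0 ≤ ⟪α, y - x⟫} := by
  obtain ⟨r, hr, h⟩ := exists_isAffineReflection hα x
  have hin : ∀ y, ⟪α, r y - x⟫ = -⟪α, y - x⟫ := fun y => by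
    rw [h, inner_affine_reflection hα]
  have hrr : ∀ y, r (r y) = y := fun y => by
    rw [h (r y), hin, h y]; module
  have him : r '' {y | 0 ≤ ⟪α, y - x⟫} = {y | ⟪α, y - x⟫ ≤ 0} := by
    ext y
    constructor
    · rintro ⟨z, hz, rfl⟩
      simp only [mem_ofPred_eq, hin] at hz ⊢
      linarith
    · intro hy
      refine ⟨r y, ?_, hrr y⟩
      simp only [mem_ofPred_eq, hin] at hy ⊢
      linarith
  refine ⟨r, hr, ?_, ?_, ?_, ?_, ?_⟩
  · ext y
    rw [mem_ofPred_eq, mem_ofPred_eq, h, fixed_iff hα]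
  · exact isClosed_le continuous_const (by fun_prop)
  · intro a ha b hb s t hs ht hst
    simp only [mem_ofPred_eq] at *
    have : s • a + t • b - x = s • (a - x) + t • (b - x) := by
      rw [smul_sub, smul_sub, sub_add_sub_comm, ← add_smul, hst, one_smul]
    rw [this, inner_add_right, inner_smul_right, inner_smul_right]
    positivity
  · rw [him]
    ext y
    simp only [mem_union, mem_ofPred_eq, mem_univ, iff_true]
    exact le_total _ _
  · rw [him]
    ext y
    simp only [mem_inter_iff, mem_ofPred_eq]
    exact ⟨fun h => le_antisymm h.2 h.1, fun h => ⟨h.ge, h.le⟩⟩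

end SphericalCoxeterSystem

namespace SphericalCoxeterSystem

variable {n : ℕ} {cs : SphericalCoxeterSystem n}

theorem IsModelHalf.eq_of_mem {α x : ModelSpace n} (hα : α ∈ cs.roots) {H : Set (ModelSpace n)}
    (hH : cs.IsModelHalf {y | ⟪α, y - x⟫ = 0} H) (hx : x + α ∈ H) :
    H = {y | 0 ≤ ⟪α, y - x⟫} := by
  obtain ⟨r, hr, hM, -, hconv, huniv, hinter⟩ := hH
  have hxM : x ∈ {y | r y = y} := by rw [← hM]; simp
  obtain ⟨β, hβ, h⟩ := hr.exists_root hxM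
  have hβα : β = α ∨ β = -α := by
    refine eq_or_eq_neg_of_forall_inner (norm_of_mem_roots hα) (norm_of_mem_roots hβ) fun z hz => ?_
    have : x + z ∈ {y | r y = y} := by rw [← hM]; simpa using hz
    rw [mem_ofPred_eq, h, fixed_iff hβ] at this
    simpa using this
  have h : ∀ y, r y = y - (2 * ⟪α, y - x⟫) • α := by
    rcases hβα with rfl | rfl
    · exact h
    · intro y
      rw [h, inner_neg_left]
      module
  have hin : ∀ y, ⟪α, r y - x⟫ = -⟪α, y - x⟫ := fun y => by
    rw [h, inner_affine_reflection hα]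
  have hrr : ∀ y, r (r y) = y := fun y => by
    rw [h (r y), hin, h y]; module
  have hMH : ∀ y, ⟪α, y - x⟫ = 0 → y ∈ H := fun y hy => by
    have : y ∈ H ∩ r '' H := by rw [hinter]; exact hy
    exact this.1
  have hsub : ∀ y ∈ H, 0 ≤ ⟪α, y - x⟫ := by
    intro y hy
    by_contra! hneg
    set c := -⟪α, y - x⟫ with hc
    have hc0 : 0 < c := by linarith
    set θ : ℝ := min (1 / 2) (c⁻¹) with hθ
    have hθ0 : 0 < θ := by positivity
    have hθ1 : θ ≤ 1 / 2 := min_le_left _ _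
    have hθc : θ * c ≤ 1 := by
      calc θ * c ≤ c⁻¹ * c := by gcongr; exact min_le_right _ _
        _ = 1 := inv_mul_cancel₀ hc0.ne'
    have hαα := inner_self_of_mem_roots hα
    set p := x - (θ * c) • α with hp
    have hrp : r p = x + (θ * c) • α := by
      rw [h, hp, show x - (θ * c) • α - x = -((θ * c) • α) by abel, inner_neg_right,
        inner_smul_right, hαα]
      module
    have hrpH : r p ∈ H := by
      rw [hrp, show x + (θ * c) • α = (1 - θ * c) • x + (θ * c) • (x + α) by module]
      exact hconv (hMH x (by simp)) hx (by linarith) (by positivity) (by ring)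
    have hpH : p ∈ H := by
      have hne : (1 : ℝ) - θ ≠ 0 := by linarith
      have hm : ⟪α, ((1 - θ)⁻¹ • (p - θ • y)) - x⟫ = 0 := by
        have : ((1 - θ)⁻¹ • (p - θ • y)) - x = (1 - θ)⁻¹ • (-(θ * c) • α - θ • (y - x)) := by
          rw [hp, eq_comm, ← sub_eq_zero]
          match_scalars <;> field_simp <;> ring
        rw [this, inner_smul_right, inner_sub_right, inner_smul_right, inner_smul_right, hαα,
          show ⟪α, y - x⟫ = -c by rw [hc, neg_neg]]
        ring
      have : p = (1 - θ) • ((1 - θ)⁻¹ • (p - θ • y)) + θ • y := by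
        rw [smul_inv_smul₀ hne]; abel
      rw [this]
      exact hconv (hMH _ hm) hy (by linarith) hθ0.le (by ring)
    have hpM : p ∈ H ∩ r '' H := ⟨hpH, r p, hrpH, hrr p⟩
    rw [hinter, mem_ofPred_eq, hp, show x - (θ * c) • α - x = -((θ * c) • α) by abel,
      inner_neg_right, inner_smul_right, hαα] at hpM
    have : 0 < θ * c := by positivity
    linarith
  refine Subset.antisymm hsub fun y hy => ?_
  have : y ∈ H ∪ r '' H := by rw [huniv]; trivial
  rcases this with hyH | ⟨z, hz, rfl⟩
  · exact hyH
  · have h1 := hsub z hz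
    rw [mem_ofPred_eq, hin] at hy
    exact hMH _ (by rw [hin]; linarith)

theorem IsModelHalf.eq_or_eq {α x : ModelSpace n} (hα : α ∈ cs.roots) {H : Set (ModelSpace n)}
    (hH : cs.IsModelHalf {y | ⟪α, y - x⟫ = 0} H) :
    H = {y | 0 ≤ ⟪α, y - x⟫} ∨ H = {y | ⟪α, y - x⟫ ≤ 0} := by
  by_cases hx : x + α ∈ H
  · exact Or.inl (hH.eq_of_mem hα hx)
  · right
    have hH' : cs.IsModelHalf {y | ⟪-α, y - x⟫ = 0} H := by
      simpa only [inner_neg_left, neg_eq_zero] using hH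
    rw [hH'.eq_of_mem (neg_mem_roots hα)]
    · simp only [inner_neg_left, Left.nonneg_neg_iff]
    · obtain ⟨r, hr, hM, -, -, huniv, -⟩ := hH'
      have hxM : x ∈ {y | r y = y} := by rw [← hM]; simp
      have : x + α ∈ H ∪ r '' H := by rw [huniv]; trivial
      rcases this.resolve_left hx with ⟨z, hz, hzx⟩
      have hα' : x + -α ∈ H ∪ r '' H := by rw [huniv]; trivial
      rcases hα' with h | ⟨z', hz', hzx'⟩
      · exact h
      · obtain ⟨β, hβ, h⟩ := hr.exists_root hxM
        have hβα : β = -α ∨ β = - -α := by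
          refine eq_or_eq_neg_of_forall_inner (norm_of_mem_roots (neg_mem_roots hα))
            (norm_of_mem_roots hβ) fun z hz => ?_
          have : x + z ∈ {y | r y = y} := by rw [← hM]; simpa using hz
          rw [mem_ofPred_eq, h, fixed_iff hβ] at this
          simpa using this
        have h2 : r (x + -α) = x + α := by
          rw [h, add_sub_cancel_left]
          have hαα := inner_self_of_mem_roots hα
          rcases hβα with rfl | rfl <;> simp only [inner_neg_left, inner_neg_right, hαα] <;> module
        rw [← hzx] at h2
        rwa [r.injective h2]

theorem Regular.pos_or_neg_pos {v α : ModelSpace n} (hv : cs.Regular v) (hα : α ∈ cs.roots) :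
    0 < ⟪α, v⟫ ∨ 0 < ⟪-α, v⟫ := by
  rw [inner_neg_left, neg_pos]
  exact (hv α hα).symm.lt_or_gt

theorem isModelSectorFace_chamber {v : ModelSpace n} (hv : cs.Regular v) (x : ModelSpace n) :
    cs.IsModelSectorFace x {y | y - x ∈ cs.chamber v} := by
  refine ⟨⟨x, fun α _ _ => by simp⟩, fun M => {y | ∀ α ∈ cs.roots, M = {y | ⟪α, y - x⟫ = 0} →
    0 < ⟪α, v⟫ → 0 ≤ ⟪α, y - x⟫}, fun M hM hx => Or.inr ?_, ?_⟩
  · obtain ⟨α, hα, hαv, rfl⟩ : ∃ α ∈ cs.roots, 0 < ⟪α, v⟫ ∧ M = {y | ⟪α, y - x⟫ = 0} := by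
      obtain ⟨α, hα, rfl⟩ := isModelWall_and_mem_iff.mp ⟨hM, hx⟩
      rcases hv.pos_or_neg_pos hα with h | h
      · exact ⟨α, hα, h, rfl⟩
      · exact ⟨-α, neg_mem_roots hα, h, by simp only [inner_neg_left, neg_eq_zero]⟩
    convert isModelHalf_of_root hα x using 1
    ext y
    refine ⟨fun h => h α hα rfl hαv, fun h β hβ hβα hβv => ?_⟩
    rcases eq_or_eq_neg_of_forall_inner (norm_of_mem_roots hα) (norm_of_mem_roots hβ)
      fun z hz => by
        have : x + z ∈ {y | ⟪α, y - x⟫ = 0} := by simpa using hz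
        rw [hβα] at this
        simpa using this with rfl | rfl
    · exact h
    · rw [inner_neg_left] at hβv
      linarith
  · ext y
    simp only [mem_iInter]
    constructor
    · intro h M _ α hα _ hαv
      exact h α hα hαv
    · intro h α hα hαv
      exact h {y | ⟪α, y - x⟫ = 0} (isModelWall_and_mem_iff.mpr ⟨α, hα, rfl⟩) α hα rfl hαv

theorem IsModelSectorFace.subset_chamber {x : ModelSpace n} {F : Set (ModelSpace n)}
    (hF : cs.IsModelSectorFace x F) :
    ∃ v, cs.Regular v ∧ F ⊆ {y | y - x ∈ cs.chamber v} := by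
  obtain ⟨⟨p₀, hp₀⟩, σ, hσ, rfl⟩ := hF
  set F := ⋂ M ∈ {M | cs.IsModelWall M ∧ x ∈ M}, σ M with hFdef
  have hsign : ∀ α ∈ cs.roots, ∀ y ∈ F, ⟪α, y - x⟫ < 0 → ∀ z ∈ F, ⟪α, z - x⟫ ≤ 0 := by
    intro α hα y hy hyα z hz
    have hM := (isModelWall_and_mem_iff (x := x)).mpr ⟨α, hα, rfl⟩
    have hmem : ∀ z ∈ F, z ∈ σ {y | ⟪α, y - x⟫ = 0} := fun z hz => by
      simp only [hFdef, mem_iInter] at hz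
      exact hz _ hM
    have h1 := hmem y hy
    have h2 := hmem z hz
    rcases hσ _ hM.1 hM.2 with h | h
    · rw [h] at h2; exact le_of_eq h2
    · rcases h.eq_or_eq hα with h | h
      · rw [h] at h1; exact absurd h1 (not_le.mpr hyα)
      · rw [h] at h2; exact h2
  have hchoose : ∀ α : ModelSpace n, ∃ p ∈ F, (∃ q ∈ F, ⟪α, q - x⟫ < 0) → ⟪α, p - x⟫ < 0 := by
    intro α
    by_cases h : ∃ q ∈ F, ⟪α, q - x⟫ < 0
    · obtain ⟨q, hq, h⟩ := h
      exact ⟨q, hq, fun _ => h⟩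
    · exact ⟨p₀, hp₀, fun h' => absurd h' h⟩
  choose p hpF hp using hchoose
  set P := ∑ β ∈ cs.finite_roots.toFinset, (p β - x) with hP
  have hPneg : ∀ α ∈ cs.roots, (∃ q ∈ F, ⟪α, q - x⟫ < 0) → ⟪α, P⟫ < 0 := by
    intro α hα h
    rw [hP, inner_sum]
    refine Finset.sum_neg' (fun β _ => ?_) ⟨α, by simpa using hα, hp α h⟩
    exact hsign α hα _ (hpF α) (hp α h) _ (hpF β)
  obtain ⟨q, hq⟩ := cs.exists_regular
  have hev : ∀ᶠ ε : ℝ in nhdsWithin 0 (Ioi 0), ∀ α ∈ cs.roots,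
      (⟪α, P⟫ < 0 → ⟪α, P⟫ + ε * ⟪α, q⟫ < 0) ∧ ⟪α, P⟫ + ε * ⟪α, q⟫ ≠ 0 := by
    rw [Filter.eventually_all_finite cs.finite_roots]
    intro α hα
    have hcont : Filter.Tendsto (fun ε : ℝ => ⟪α, P⟫ + ε * ⟪α, q⟫) (nhdsWithin 0 (Ioi 0))
        (nhds ⟪α, P⟫) := by
      have : Continuous fun ε : ℝ => ⟪α, P⟫ + ε * ⟪α, q⟫ := by fun_prop
      have := (this.tendsto 0).mono_left (nhdsWithin_le_nhds (s := Ioi 0))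
      simpa using this
    refine Filter.Eventually.and ?_ ?_
    · by_cases h : ⟪α, P⟫ < 0
      · filter_upwards [hcont.eventually_lt_const h] with ε hε _ using hε
      · exact Filter.Eventually.of_forall fun ε h' => absurd h' h
    · by_cases h : ⟪α, P⟫ = 0
      · filter_upwards [self_mem_nhdsWithin] with ε hε
        rw [h, zero_add]
        exact mul_ne_zero (ne_of_gt hε) (hq α hα)
      · exact hcont.eventually_ne h
  obtain ⟨ε, hε⟩ := hev.exists
  have hin : ∀ α, ⟪α, P + ε • q⟫ = ⟪α, P⟫ + ε * ⟪α, q⟫ := fun α => by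
    rw [inner_add_right, inner_smul_right]
  refine ⟨P + ε • q, fun α hα => by rw [hin]; exact (hε α hα).2, fun y hy α hα hαv => ?_⟩
  by_contra! hneg
  have := (hε α hα).1 (hPneg α hα ⟨y, hy, hneg⟩)
  rw [hin] at hαv
  linarith

theorem IsModelSectorFace.eq_chamber {v x : ModelSpace n}
    {F : Set (ModelSpace n)} (hF : cs.IsModelSectorFace x F)
    (h : {y | y - x ∈ cs.chamber v} ⊆ F) : F = {y | y - x ∈ cs.chamber v} := by
  refine Subset.antisymm (fun y hy α hα hαv => ?_) h
  have hxv : x + v ∈ F := h (by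
    rw [mem_ofPred_eq, add_sub_cancel_left]; exact fun β _ hβ => hβ.le)
  obtain ⟨-, σ, hσ, rfl⟩ := hF
  have hM := (isModelWall_and_mem_iff (x := x)).mpr ⟨α, hα, rfl⟩
  simp only [mem_iInter] at hxv hy
  have h1 := hxv _ hM
  have h2 := hy _ hM
  rcases hσ _ hM.1 hM.2 with h | h
  · rw [h, mem_ofPred_eq, add_sub_cancel_left] at h1
    exact absurd h1 hαv.ne'
  · rcases h.eq_or_eq hα with h | h
    · rwa [h] at h2
    · rw [h, mem_ofPred_eq, add_sub_cancel_left] at h1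
      exact absurd h1 (not_le.mpr hαv)

/-- Sectors of the model space are the translated chambers. -/
theorem isModelSector_iff {x : ModelSpace n} {F : Set (ModelSpace n)} :
    cs.IsModelSector x F ↔ ∃ v, cs.Regular v ∧ F = {y | y - x ∈ cs.chamber v} := by
  constructor
  · rintro ⟨hF, hmax⟩
    obtain ⟨v, hv, h⟩ := hF.subset_chamber
    exact ⟨v, hv, (hmax _ (isModelSectorFace_chamber hv x) h).symm⟩
  · rintro ⟨v, hv, rfl⟩
    exact ⟨isModelSectorFace_chamber hv x, fun F' hF' h => hF'.eq_chamber h⟩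

end SphericalCoxeterSystem

namespace SphericalCoxeterSystem

variable {n : ℕ} {cs : SphericalCoxeterSystem n} {v : ModelSpace n}

theorem zero_mem_chamber : (0 : ModelSpace n) ∈ cs.chamber v := fun α _ _ => by simp

theorem self_mem_chamber : v ∈ cs.chamber v := fun _ _ h => h.le

theorem add_mem_chamber {x y : ModelSpace n} (hx : x ∈ cs.chamber v) (hy : y ∈ cs.chamber v) :
    x + y ∈ cs.chamber v := fun α hα h => by
  rw [inner_add_right]
  exact add_nonneg (hx α hα h) (hy α hα h)

theorem smul_mem_chamber {x : ModelSpace n} (hx : x ∈ cs.chamber v) {t : ℝ} (ht : 0 ≤ t) :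
    t • x ∈ cs.chamber v := fun α hα h => by
  rw [inner_smul_right]
  exact mul_nonneg ht (hx α hα h)

theorem Regular.map (hv : cs.Regular v) {w : ModelSpace n ≃ᵢ ModelSpace n} (hw : w ∈ cs.Wbar) :
    cs.Regular (w v) := fun α hα => by
  rw [← Wbar_inner_inv_left hw]
  exact hv _ (map_mem_roots hα (inv_mem hw))

theorem map_mem_chamber_iff {w : ModelSpace n ≃ᵢ ModelSpace n} (hw : w ∈ cs.Wbar)
    (y : ModelSpace n) : w y ∈ cs.chamber (w v) ↔ y ∈ cs.chamber v := by
  constructor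
  · intro h α hα hαv
    have := h (w α) (map_mem_roots hα hw)
    rw [Wbar_inner_map hw, Wbar_inner_map hw] at this
    exact this hαv
  · intro h α hα hαv
    rw [← Wbar_inner_inv_left hw] at hαv ⊢
    exact h _ (map_mem_roots hα (inv_mem hw)) hαv

theorem image_chamber {w : ModelSpace n ≃ᵢ ModelSpace n} (hw : w ∈ cs.Wbar) :
    w '' cs.chamber v = cs.chamber (w v) := by
  ext y
  constructor
  · rintro ⟨z, hz, rfl⟩
    exact (map_mem_chamber_iff hw z).mpr hz
  · intro hy
    refine ⟨w⁻¹ y, ?_, apply_inv_apply w y⟩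
    rwa [← map_mem_chamber_iff hw, apply_inv_apply]

theorem chamber_eq_of_pos_imp {v' : ModelSpace n} (hv : cs.Regular v)
    (h : ∀ α ∈ cs.roots, 0 < ⟪α, v⟫ → 0 < ⟪α, v'⟫) : cs.chamber v = cs.chamber v' := by
  have h' : ∀ α ∈ cs.roots, 0 < ⟪α, v'⟫ → 0 < ⟪α, v⟫ := fun α hα hp => by
    rcases hv.pos_or_neg_pos hα with h1 | h1
    · exact h1
    · have := h _ (neg_mem_roots hα) h1
      rw [inner_neg_left] at this
      linarith
  ext y
  exact ⟨fun hy α hα hp => hy α hα (h' α hα hp), fun hy α hα hp => hy α hα (h α hα hp)⟩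

theorem chamber_eq_of_mem {v' : ModelSpace n} (hv : cs.Regular v) (hv' : cs.Regular v')
    (h : v' ∈ cs.chamber v) : cs.chamber v = cs.chamber v' :=
  chamber_eq_of_pos_imp hv fun α hα hp => lt_of_le_of_ne (h α hα hp) (hv' α hα).symm

theorem pos_map_of_chamber_eq {u : ModelSpace n ≃ᵢ ModelSpace n} (hv : cs.Regular v)
    (hu : u ∈ cs.Wbar) (h : cs.chamber (u v) = cs.chamber v) {α : ModelSpace n}
    (hα : α ∈ cs.roots) (hp : 0 < ⟪α, v⟫) : 0 < ⟪α, u v⟫ :=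
  lt_of_le_of_ne ((h ▸ self_mem_chamber : u v ∈ cs.chamber v) α hα hp)
    ((hv.map hu) α hα).symm

variable (cs v) in
/-- `s` is the reflection in the wall of a simple root `α` of the chamber of `v`. -/
structure Simple (s : ModelSpace n ≃ᵢ ModelSpace n) (α : ModelSpace n) : Prop where
  root : α ∈ cs.roots
  pos : 0 < ⟪α, v⟫
  mem : s ∈ cs.Wbar
  refl : IsReflectionIn s α
  perm : ∀ β ∈ cs.roots, 0 < ⟪β, v⟫ → β ≠ α → 0 < ⟪β, s v⟫

theorem exists_simple_of_neg (hv : cs.Regular v) {y : ModelSpace n}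
    (h : ∃ β ∈ cs.roots, 0 < ⟪β, v⟫ ∧ ⟪β, y⟫ < 0) :
    ∃ s α, cs.Simple v s α ∧ ⟪α, y⟫ < 0 := by
  obtain ⟨β₀, hβ₀, hβ₀v, hβ₀y⟩ := h
  set φ : ModelSpace n → ℝ := fun β => ⟪β, y⟫ / ⟪β, v⟫ with hφ
  obtain ⟨α₀, ⟨hα₀, hα₀v⟩, hmin₀⟩ := exists_min_image {β | β ∈ cs.roots ∧ 0 < ⟪β, v⟫} φ
    (cs.finite_roots.subset fun _ h => h.1) ⟨β₀, hβ₀, hβ₀v⟩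
  obtain ⟨α, ⟨hα, hαv, hαφ⟩, hmin⟩ := exists_min_image
    {β | β ∈ cs.roots ∧ 0 < ⟪β, v⟫ ∧ φ β = φ α₀} (fun β => ⟪β, v⟫)
    (cs.finite_roots.subset fun _ h => h.1) ⟨α₀, hα₀, hα₀v, rfl⟩
  have hval : ∀ β, 0 < ⟪β, v⟫ → ⟪β, y⟫ = φ β * ⟪β, v⟫ := fun β hβ =>
    (div_mul_cancel₀ _ hβ.ne').symm
  have hge : ∀ β ∈ cs.roots, 0 < ⟪β, v⟫ → φ α ≤ φ β := fun β hβ hβv => by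
    rw [hαφ]; exact hmin₀ β ⟨hβ, hβv⟩
  obtain ⟨r, hr, hrα⟩ := exists_reflection_of_mem_roots hα
  refine ⟨r, α, ⟨hα, hαv, hr, hrα, fun β hβ hβv hne => ?_⟩, ?_⟩
  · by_contra! hle
    have hle' : ⟪β, r v⟫ < 0 := lt_of_le_of_ne hle (hv.map hr β hβ)
    set c := ⟪α, β⟫ with hc
    have hγ : r β = β - (2 * c) • α := hrα.2 β
    have hγv : ⟪β, r v⟫ = ⟪β, v⟫ - 2 * c * ⟪α, v⟫ := by
      rw [← hrα.inner_comm, hγ, inner_sub_left, real_inner_smul_left]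
    have hγpos : 0 < ⟪-(r β), v⟫ := by
      rw [inner_neg_left, hrα.inner_comm]; linarith
    have hγr : -(r β) ∈ cs.roots := neg_mem_roots (map_mem_roots hβ hr)
    have h1 := hval _ hβv
    have h2 := hval _ hγpos
    have h3 := hval _ hαv
    have hg1 := hge _ hβ hβv
    have hg2 := hge _ hγr hγpos
    have ev : ⟪-(r β), v⟫ = 2 * c * ⟪α, v⟫ - ⟪β, v⟫ := by
      rw [inner_neg_left, hγ, inner_sub_left, real_inner_smul_left]; ring
    have ey : ⟪-(r β), y⟫ = 2 * c * ⟪α, y⟫ - ⟪β, y⟫ := by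
      rw [inner_neg_left, hγ, inner_sub_left, real_inner_smul_left]; ring
    have hsum : (φ β - φ α) * ⟪β, v⟫ + (φ (-(r β)) - φ α) * ⟪-(r β), v⟫ = 0 := by
      have : φ (-(r β)) * ⟪-(r β), v⟫ = 2 * c * (φ α * ⟪α, v⟫) - φ β * ⟪β, v⟫ := by
        rw [← h2, ey, h1, h3]
      rw [sub_mul, sub_mul, this, ev]; ring
    have hp1 : 0 ≤ (φ β - φ α) * ⟪β, v⟫ := mul_nonneg (by linarith) hβv.le
    have hp2 : 0 ≤ (φ (-(r β)) - φ α) * ⟪-(r β), v⟫ := mul_nonneg (by linarith) hγpos.le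
    have e1 : φ β = φ α := by
      have : (φ β - φ α) * ⟪β, v⟫ = 0 := by linarith
      linarith [(mul_eq_zero.mp this).resolve_right hβv.ne']
    have e2 : φ (-(r β)) = φ α := by
      have : (φ (-(r β)) - φ α) * ⟪-(r β), v⟫ = 0 := by linarith
      linarith [(mul_eq_zero.mp this).resolve_right hγpos.ne']
    have m1 := hmin β ⟨hβ, hβv, e1.trans hαφ⟩
    have m2 := hmin _ ⟨hγr, hγpos, e2.trans hαφ⟩
    simp only [ev] at m2
    have hc1 : 1 ≤ c := by
      have : 0 ≤ (c - 1) * ⟪α, v⟫ := by linarith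
      have := nonneg_of_mul_nonneg_left this hαv
      linarith
    have hc2 : c ≤ 1 := by
      have := real_inner_le_norm α β
      rwa [norm_of_mem_roots hα, norm_of_mem_roots hβ, one_mul] at this
    exact hne ((inner_eq_one_iff_of_norm_eq_one (norm_of_mem_roots hα)
      (norm_of_mem_roots hβ)).mp (le_antisymm hc2 hc1)).symm
  · rw [hval α hαv]
    have h1 := hge β₀ hβ₀ hβ₀v
    have h2 : φ β₀ < 0 := div_neg_of_neg_of_pos hβ₀y hβ₀v
    exact mul_neg_of_neg_of_pos (by linarith) hαv

variable (cs v) in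
/-- The positive roots negative at `y`. -/
def inversions (y : ModelSpace n) : Set (ModelSpace n) :=
  {α | α ∈ cs.roots ∧ 0 < ⟪α, v⟫ ∧ ⟪α, y⟫ < 0}

theorem finite_inversions (y : ModelSpace n) : (cs.inversions v y).Finite :=
  cs.finite_roots.subset fun _ h => h.1

theorem Simple.apply_root {s : ModelSpace n ≃ᵢ ModelSpace n} {α : ModelSpace n}
    (h : cs.Simple v s α) : s α = -α := by
  rw [h.refl.2, inner_self_of_mem_roots h.root]; module

theorem Simple.mapsTo {s : ModelSpace n ≃ᵢ ModelSpace n} {α : ModelSpace n}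
    (h : cs.Simple v s α) (y : ModelSpace n) :
    s '' (cs.inversions v (s y) \ {α}) ⊆ cs.inversions v y \ {α} := by
  rintro _ ⟨β, ⟨⟨hβ, hβv, hβy⟩, hne⟩, rfl⟩
  refine ⟨⟨map_mem_roots hβ h.mem, ?_, ?_⟩, fun h' => ?_⟩
  · rw [h.refl.inner_comm]
    exact h.perm β hβ hβv hne
  · rwa [h.refl.inner_comm]
  · have : β = -α := by
      rw [← h.refl.apply_apply β, mem_singleton_iff.mp h', h.apply_root]
    rw [this, inner_neg_left] at hβv
    linarith [h.pos]

theorem Simple.ncard_lt {s : ModelSpace n ≃ᵢ ModelSpace n} {α : ModelSpace n}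
    (h : cs.Simple v s α) {y : ModelSpace n} (hy : ⟪α, y⟫ < 0) :
    (cs.inversions v (s y)).ncard < (cs.inversions v y).ncard := by
  have h1 := ncard_le_ncard (h.mapsTo y) (finite_inversions y).sdiff
  rw [ncard_image_of_injective _ s.injective] at h1
  have hα : α ∈ cs.inversions v y := ⟨h.root, h.pos, hy⟩
  have hα' : α ∉ cs.inversions v (s y) := fun h' => by
    have := h'.2.2
    rw [← h.refl.inner_comm, h.apply_root, inner_neg_left] at this
    linarith
  rw [sdiff_singleton_eq_self hα'] at h1
  exact h1.trans_lt (ncard_sdiff_singleton_lt_of_mem hα (finite_inversions y))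

theorem Simple.ncard_le {s : ModelSpace n ≃ᵢ ModelSpace n} {α : ModelSpace n}
    (h : cs.Simple v s α) (y : ModelSpace n) :
    (cs.inversions v (s y)).ncard ≤ (cs.inversions v y).ncard + 1 := by
  have h1 := ncard_le_ncard ((h.mapsTo y).trans sdiff_subset) (finite_inversions y)
  rw [ncard_image_of_injective _ s.injective] at h1
  have h2 := ncard_le_ncard_sdiff_add_ncard (cs.inversions v (s y)) {α}
  rw [ncard_singleton] at h2
  omega

variable (cs v) in
/-- A word in the simple reflections of the chamber of `v`. -/
def IsWord (l : List (ModelSpace n ≃ᵢ ModelSpace n)) : Prop :=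
  ∀ s ∈ l, ∃ α, cs.Simple v s α

theorem isWord_nil : cs.IsWord v [] := fun _ h => absurd h List.not_mem_nil

theorem isWord_cons {s : ModelSpace n ≃ᵢ ModelSpace n} {l : List (ModelSpace n ≃ᵢ ModelSpace n)} :
    cs.IsWord v (s :: l) ↔ (∃ α, cs.Simple v s α) ∧ cs.IsWord v l := by
  simp [IsWord]

theorem IsWord.sublist {l l' : List (ModelSpace n ≃ᵢ ModelSpace n)} (h : cs.IsWord v l)
    (hl : l'.Sublist l) : cs.IsWord v l' := fun s hs => h s (hl.subset hs)

theorem IsWord.prod_mem {l : List (ModelSpace n ≃ᵢ ModelSpace n)} (h : cs.IsWord v l) :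
    l.prod ∈ cs.Wbar :=
  Subgroup.list_prod_mem _ fun s hs => (h s hs).choose_spec.mem

theorem IsWord.ncard_le {l : List (ModelSpace n ≃ᵢ ModelSpace n)} (h : cs.IsWord v l) :
    (cs.inversions v (l.prod v)).ncard ≤ l.length := by
  induction l with
  | nil =>
    have : cs.inversions v (([] : List (ModelSpace n ≃ᵢ ModelSpace n)).prod v) = ∅ := by
      ext α
      simp only [List.prod_nil, mem_empty_iff_false, iff_false]
      rintro ⟨_, h1, h2⟩
      exact lt_asymm h1 h2
    rw [this, ncard_empty]
    exact Nat.zero_le _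
  | cons s l ih =>
    obtain ⟨⟨α, hα⟩, hl⟩ := isWord_cons.mp h
    rw [List.prod_cons, IsometryEquiv.mul_apply, List.length_cons]
    exact (hα.ncard_le _).trans (Nat.add_le_add_right (ih hl) 1)

theorem chamber_eq_of_inversions_eq_empty (hv : cs.Regular v)
    {u : ModelSpace n ≃ᵢ ModelSpace n} (hu : u ∈ cs.Wbar) (h : cs.inversions v (u v) = ∅) :
    cs.chamber (u v) = cs.chamber v := by
  refine (chamber_eq_of_mem hv (hv.map hu) fun α hα hp => ?_).symm
  by_contra! hneg
  exact (h ▸ (⟨hα, hp, hneg⟩ : α ∈ cs.inversions v (u v)) : α ∈ (∅ : Set (ModelSpace n)))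

theorem exists_word (hv : cs.Regular v) {w : ModelSpace n ≃ᵢ ModelSpace n} (hw : w ∈ cs.Wbar) :
    ∃ l, cs.IsWord v l ∧ l.length ≤ (cs.inversions v (w v)).ncard ∧
      ∃ u ∈ cs.Wbar, w = l.prod * u ∧ cs.chamber (u v) = cs.chamber v := by
  induction hN : (cs.inversions v (w v)).ncard using Nat.strong_induction_on generalizing w with
  | _ N ih =>
    by_cases h : ∃ β ∈ cs.roots, 0 < ⟪β, v⟫ ∧ ⟪β, w v⟫ < 0
    · obtain ⟨s, α, hs, hα⟩ := exists_simple_of_neg hv h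
      have hlt := hs.ncard_lt hα
      rw [hN] at hlt
      obtain ⟨l, hl, hlen, u, hu, hwu, hC⟩ := ih _ hlt (mul_mem hs.mem hw) rfl
      refine ⟨s :: l, isWord_cons.mpr ⟨⟨α, hs⟩, hl⟩, ?_, u, hu, ?_, hC⟩
      · rw [List.length_cons]
        omega
      · rw [List.prod_cons, mul_assoc, ← hwu, ← mul_assoc, hs.refl.mul_self, one_mul]
    · refine ⟨[], isWord_nil, by simp, w, hw, by simp, ?_⟩
      refine chamber_eq_of_inversions_eq_empty hv hw ?_
      ext β
      simp only [mem_empty_iff_false, iff_false]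
      exact fun h' => h ⟨β, h'⟩

variable (cs v) in
/-- `w` maps the chamber of `v` to the opposite chamber. -/
def Opp (w : ModelSpace n ≃ᵢ ModelSpace n) : Prop :=
  w ∈ cs.Wbar ∧ ∀ β ∈ cs.roots, 0 < ⟪β, v⟫ → ⟪β, w v⟫ < 0

theorem exists_opp (hv : cs.Regular v) : ∃ w, cs.Opp v w := by
  have : Finite cs.Wbar := cs.finiteW
  obtain ⟨⟨w, hw⟩, hmin⟩ := Finite.exists_min
    fun w : cs.Wbar => ⟪v, (w : ModelSpace n ≃ᵢ ModelSpace n) v⟫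
  refine ⟨w, hw, fun β hβ hp => ?_⟩
  by_contra! hge
  have hpos : 0 < ⟪β, w v⟫ := lt_of_le_of_ne hge (hv.map hw β hβ).symm
  obtain ⟨r, hr, hrβ⟩ := exists_reflection_of_mem_roots hβ
  have := hmin ⟨r * w, mul_mem hr hw⟩
  simp only [IsometryEquiv.mul_apply] at this
  rw [hrβ.2, inner_sub_right, inner_smul_right, real_inner_comm β v] at this
  have : 0 < ⟪β, w v⟫ * ⟪β, v⟫ := mul_pos hpos hp
  nlinarith

theorem Opp.iff {w : ModelSpace n ≃ᵢ ModelSpace n} (hv : cs.Regular v) (h : cs.Opp v w)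
    {β : ModelSpace n} (hβ : β ∈ cs.roots) : 0 < ⟪β, v⟫ ↔ ⟪β, w v⟫ < 0 := by
  refine ⟨h.2 β hβ, fun hn => ?_⟩
  rcases hv.pos_or_neg_pos hβ with h1 | h1
  · exact h1
  · have := h.2 _ (neg_mem_roots hβ) h1
    rw [inner_neg_left] at this
    linarith

theorem Opp.inv {w : ModelSpace n ≃ᵢ ModelSpace n} (hv : cs.Regular v) (h : cs.Opp v w) :
    cs.Opp v w⁻¹ := by
  refine ⟨inv_mem h.1, fun β hβ hp => ?_⟩
  rw [← Wbar_inner_left h.1]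
  have h1 : ⟪-(w β), w v⟫ < 0 := by rw [inner_neg_left, Wbar_inner_map h.1]; linarith
  have := (h.iff hv (neg_mem_roots (map_mem_roots hβ h.1))).mpr h1
  rw [inner_neg_left] at this
  linarith

theorem Opp.mem_chamber_iff {w : ModelSpace n ≃ᵢ ModelSpace n} (hv : cs.Regular v)
    (h : cs.Opp v w) (y : ModelSpace n) : w y ∈ cs.chamber v ↔ -y ∈ cs.chamber v := by
  have h1 : cs.chamber (w v) = cs.chamber (-v) := by
    refine chamber_eq_of_pos_imp (hv.map h.1) fun α hα hp => ?_
    rw [inner_neg_right, neg_pos]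
    by_contra! hge
    have := (h.iff hv hα).mp (lt_of_le_of_ne hge (hv α hα).symm)
    linarith
  have h2 : ∀ z, z ∈ cs.chamber (-v) ↔ -z ∈ cs.chamber v := fun z => by
    constructor
    · intro hz α hα hp
      have := hz (-α) (neg_mem_roots hα) (by rwa [inner_neg_neg])
      rwa [inner_neg_left, ← inner_neg_right] at this
    · intro hz α hα hp
      have := hz (-α) (neg_mem_roots hα) (by rwa [inner_neg_left, ← inner_neg_right])
      rwa [inner_neg_neg] at this
  rw [← map_mem_chamber_iff (v := v) h.1 (-y), h1, h2, Wbar_map_neg h.1, neg_neg]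

theorem Opp.ncard {w : ModelSpace n ≃ᵢ ModelSpace n} (h : cs.Opp v w) :
    (cs.inversions v (w v)).ncard = {α | α ∈ cs.roots ∧ 0 < ⟪α, v⟫}.ncard := by
  congr 1
  ext β
  exact ⟨fun h' => ⟨h'.1, h'.2.1⟩, fun h' => ⟨h'.1, h'.2, h.2 β h'.1 h'.2⟩⟩

theorem Simple.exists_opp_word {s : ModelSpace n ≃ᵢ ModelSpace n} {α : ModelSpace n}
    (hv : cs.Regular v) (hs : cs.Simple v s α) :
    ∃ l, cs.IsWord v l ∧ cs.Opp v (s * l.prod) ∧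
      l.length < {α | α ∈ cs.roots ∧ 0 < ⟪α, v⟫}.ncard := by
  obtain ⟨w, hw⟩ := exists_opp hv
  obtain ⟨l, hl, hlen, u, hu, he, hC⟩ := exists_word hv (mul_mem hs.mem hw.1)
  have hlt := hs.ncard_lt (hw.2 α hs.root hs.pos)
  rw [hw.ncard] at hlt
  refine ⟨l, hl, ⟨mul_mem hs.mem hl.prod_mem, fun β hβ hp => ?_⟩, hlen.trans_lt hlt⟩
  have e : s * l.prod = w * u⁻¹ := by
    rw [eq_mul_inv_iff_mul_eq, mul_assoc, ← he, ← mul_assoc, hs.refl.mul_self, one_mul]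
  rw [e, IsometryEquiv.mul_apply, ← Wbar_inner_inv_left hw.1, ← Wbar_inner_left hu]
  by_contra! hge
  have hr := map_mem_roots (map_mem_roots hβ (inv_mem hw.1)) hu
  have h2 := pos_map_of_chamber_eq hv hu hC hr (lt_of_le_of_ne hge (hv _ hr).symm)
  rw [Wbar_inner_map hu, Wbar_inner_inv_left hw.1] at h2
  linarith [hw.2 β hβ hp]

theorem Simple.conj_opp {s w : ModelSpace n ≃ᵢ ModelSpace n} {α : ModelSpace n}
    (hv : cs.Regular v) (hs : cs.Simple v s α) (hw : cs.Opp v w) :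
    cs.Simple v (w⁻¹ * s * w) (-(w⁻¹ α)) := by
  have hr := map_mem_roots hs.root (inv_mem hw.1)
  refine ⟨neg_mem_roots hr, ?_, mul_mem (mul_mem (inv_mem hw.1) hs.mem) hw.1, ?_,
    fun β hβ hp hne => ?_⟩
  · rw [inner_neg_left, Wbar_inner_inv_left hw.1]
    linarith [hw.2 α hs.root hs.pos]
  · have := hs.refl.conj cs (inv_mem hw.1)
    rw [inv_inv] at this
    refine ⟨by rw [norm_neg, this.1], fun x => ?_⟩
    rw [this.2, inner_neg_left]
    module
  · simp only [IsometryEquiv.mul_apply]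
    have hγ := neg_mem_roots (map_mem_roots hβ hw.1)
    have hγv : 0 < ⟪-(w β), v⟫ := by
      rw [hw.iff hv hγ, inner_neg_left, Wbar_inner_map hw.1]; linarith
    have hγα : -(w β) ≠ α := fun h => hne (by
      rw [← h, Wbar_map_neg (inv_mem hw.1), inv_apply_apply, neg_neg])
    have h1 := hs.perm _ hγ hγv hγα
    rw [← hs.refl.inner_comm] at h1
    have h2 := hw.2 _ (map_mem_roots hγ hs.mem) h1
    rw [hs.refl.inner_comm, inner_neg_left] at h2
    rw [← Wbar_inner_left hw.1]
    linarith

end SphericalCoxeterSystem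

namespace SphericalCoxeterSystem

variable {n : ℕ} {cs : SphericalCoxeterSystem n} {v : ModelSpace n}
  {s : ModelSpace n ≃ᵢ ModelSpace n} {α : ModelSpace n}

variable (cs v s) in
/-- The points of the chamber of `v` fixed by `s`. -/
def panel : Set (ModelSpace n) := {p | p ∈ cs.chamber v ∧ s p = p}

theorem Simple.exists_panel_point (h : cs.Simple v s α) :
    ∃ p, ⟪α, p⟫ = 0 ∧ ∀ β ∈ cs.roots, 0 < ⟪β, v⟫ → β ≠ α → 0 < ⟪β, p⟫ := by
  refine ⟨v - ⟪α, v⟫ • α, ?_, fun β hβ hp hne => ?_⟩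
  · rw [inner_sub_right, inner_smul_right, inner_self_of_mem_roots h.root]; ring
  · have := h.perm β hβ hp hne
    rw [h.refl.2, inner_sub_right, inner_smul_right] at this
    rw [inner_sub_right, inner_smul_right]
    linarith

/-- A point near an interior panel direction, on the nonnegative side, lies in the chamber. -/
theorem Simple.exists_add_smul_mem (h : cs.Simple v s α) {p : ModelSpace n} (hp0 : ⟪α, p⟫ = 0)
    (hp : ∀ β ∈ cs.roots, 0 < ⟪β, v⟫ → β ≠ α → 0 < ⟪β, p⟫) {x : ModelSpace n}
    (hx : 0 ≤ ⟪α, x⟫) : ∃ t : ℝ, 0 ≤ t ∧ x + t • p ∈ cs.chamber v := by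
  have hev : ∀ᶠ t : ℝ in Filter.atTop, ∀ β ∈ cs.roots, 0 < ⟪β, v⟫ → 0 ≤ ⟪β, x + t • p⟫ := by
    rw [Filter.eventually_all_finite cs.finite_roots]
    intro β hβ
    by_cases hpos : 0 < ⟪β, v⟫
    · by_cases hne : β = α
      · subst hne
        refine Filter.Eventually.of_forall fun t _ => ?_
        rw [inner_add_right, inner_smul_right, hp0]
        linarith
      · have hpβ := hp β hβ hpos hne
        filter_upwards [Filter.eventually_ge_atTop (-⟪β, x⟫ / ⟪β, p⟫)] with t ht _
        rw [inner_add_right, inner_smul_right]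
        rw [div_le_iff₀ hpβ] at ht
        linarith
    · exact Filter.Eventually.of_forall fun t h => absurd h hpos
  obtain ⟨t, ht, ht0⟩ := (hev.and (Filter.eventually_ge_atTop 0)).exists
  exact ⟨t, ht0, ht⟩

theorem Simple.mem_panel (h : cs.Simple v s α) {p : ModelSpace n} (hp0 : ⟪α, p⟫ = 0)
    (hp : ∀ β ∈ cs.roots, 0 < ⟪β, v⟫ → β ≠ α → 0 < ⟪β, p⟫) : p ∈ cs.panel v s := by
  refine ⟨fun β hβ hpos => ?_, (h.refl.apply_eq_self_iff p).mpr hp0⟩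
  by_cases hne : β = α
  · rw [hne, hp0]
  · exact (hp β hβ hpos hne).le

theorem Simple.eq_one_or_eq_of_fix_panel (h : cs.Simple v s α)
    {w : ModelSpace n ≃ᵢ ModelSpace n} (hw : w ∈ cs.Wbar)
    (hfix : ∀ p ∈ cs.panel v s, w p = p) : w = 1 ∨ w = s := by
  obtain ⟨p, hp0, hp⟩ := h.exists_panel_point
  have hpm := h.mem_panel hp0 hp
  have hperp : ∀ z, ⟪α, z⟫ = 0 → w z = z := fun z hz => by
    obtain ⟨t, -, ht⟩ := h.exists_add_smul_mem hp0 hp hz.ge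
    have h1 := hfix (z + t • p) ⟨ht, (h.refl.apply_eq_self_iff _).mpr (by
      rw [inner_add_right, inner_smul_right, hz, hp0]; ring)⟩
    rwa [Wbar_map_add hw, Wbar_map_smul hw, hfix p hpm, add_left_inj] at h1
  have hα : w α = α ∨ w α = -α := by
    refine eq_or_eq_neg_of_forall_inner (norm_of_mem_roots h.root)
      (norm_of_mem_roots (map_mem_roots h.root hw)) fun z hz => ?_
    rw [← hperp z hz, Wbar_inner_map hw, hz]
  have hdec : ∀ x, w x = ⟪α, x⟫ • w α + (x - ⟪α, x⟫ • α) := fun x => by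
    have : w (x - ⟪α, x⟫ • α) = x - ⟪α, x⟫ • α := hperp _ (by
      rw [inner_sub_right, inner_smul_right, inner_self_of_mem_roots h.root]; ring)
    conv_lhs => rw [← add_sub_cancel (⟪α, x⟫ • α) x, Wbar_map_add hw, this, Wbar_map_smul hw]
  refine hα.imp (fun e => ?_) fun e => ?_
  · ext1 x
    rw [hdec, e, add_sub_cancel]
    rfl
  · ext1 x
    rw [hdec, e, h.refl.2]
    module

theorem _root_.Convex.add_mem_of_ray {E : Type*} [NormedAddCommGroup E] [NormedSpace ℝ E]
    {K : Set E} (hK : Convex ℝ K) (hc : IsClosed K) {x u : E}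
    (hray : ∀ t : ℝ, 0 ≤ t → x + t • u ∈ K) {y : E} (hy : y ∈ K) : y + u ∈ K := by
  have hlim : Filter.Tendsto (fun m : ℝ => y + u + m⁻¹ • (x - y)) Filter.atTop (nhds (y + u)) := by
    have := (tendsto_inv_atTop_zero (𝕜 := ℝ)).smul_const (x - y)
    rw [zero_smul] at this
    simpa using this.const_add (y + u)
  refine hc.mem_of_tendsto hlim ?_
  filter_upwards [Filter.eventually_ge_atTop 1] with m hm
  have hm0 : m ≠ 0 := by linarith
  have : y + u + m⁻¹ • (x - y) = (1 - m⁻¹) • y + m⁻¹ • (x + m • u) := by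
    rw [smul_add, inv_smul_smul₀ hm0]; module
  rw [this]
  exact hK hy (hray m (by linarith)) (by linarith [inv_le_one_of_one_le₀ hm]) (by positivity)
    (by ring)

/-- A closed convex set containing translates of a chamber and of the chamber opposite to its
neighbour across a wall is everything or a half-space bounded by a parallel wall. -/
theorem Simple.eq_univ_or_eq_half (h : cs.Simple v s α) {K : Set (ModelSpace n)}
    (hK : Convex ℝ K) (hc : IsClosed K) {x y : ModelSpace n}
    (hx : ∀ c ∈ cs.chamber v, x + c ∈ K) (hy : ∀ c ∈ cs.chamber v, y - s c ∈ K) :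
    K = univ ∨ ∃ κ : ℝ, K = {z | κ ≤ ⟪α, z⟫} := by
  obtain ⟨p, hp0, hp⟩ := h.exists_panel_point
  have hpm := h.mem_panel hp0 hp
  have hrec : ∀ z, 0 ≤ ⟪α, z⟫ → ∀ q ∈ K, q + z ∈ K := fun z hz q hq => by
    obtain ⟨t, ht, hzt⟩ := h.exists_add_smul_mem hp0 hp hz
    have h1 := hK.add_mem_of_ray hc (u := z + t • p)
      (fun a ha => hx _ (smul_mem_chamber hzt ha)) hq
    have h2 := hK.add_mem_of_ray hc (x := y) (u := -(t • p)) (fun a ha => by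
      have e := hy (a • t • p) (smul_mem_chamber (smul_mem_chamber hpm.1 ht) ha)
      rw [Wbar_map_smul h.mem, Wbar_map_smul h.mem, hpm.2] at e
      rwa [smul_neg, ← sub_eq_add_neg]) h1
    convert h2 using 1
    abel
  have hαα := inner_self_of_mem_roots h.root
  set I : Set ℝ := {k | k • α ∈ K} with hI
  have hmemI : ∀ z, z ∈ K ↔ ⟪α, z⟫ ∈ I := fun z => by
    have e : ⟪α, z - ⟪α, z⟫ • α⟫ = 0 := by
      rw [inner_sub_right, inner_smul_right, hαα]; ring
    constructor
    · intro hz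
      have := hrec (-(z - ⟪α, z⟫ • α)) (by rw [inner_neg_right, e, neg_zero]) z hz
      rwa [← sub_eq_add_neg, sub_sub_cancel] at this
    · intro hz
      have := hrec _ e.ge _ hz
      rwa [add_sub_cancel] at this
  have hup : ∀ a ∈ I, ∀ b, a ≤ b → b ∈ I := fun a ha b hab => by
    have := hrec ((b - a) • α) (by rw [inner_smul_right, hαα]; linarith) _ ha
    rwa [← add_smul, add_sub_cancel] at this
  have hIc : IsClosed I := hc.preimage (f := fun k : ℝ => k • α) (by fun_prop)
  have hIne : I.Nonempty := ⟨_, (hmemI x).mp (by simpa using hx 0 zero_mem_chamber)⟩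
  by_cases hb : BddBelow I
  · right
    refine ⟨sInf I, ?_⟩
    ext z
    rw [hmemI, mem_ofPred_eq]
    exact ⟨fun hz => csInf_le hb hz, fun hz => hup _ (hIc.csInf_mem hIne hb) _ hz⟩
  · left
    refine eq_univ_of_forall fun z => (hmemI z).mpr ?_
    rw [not_bddBelow_iff] at hb
    obtain ⟨a, ha, hlt⟩ := hb ⟪α, z⟫
    exact hup a ha _ hlt.le

end SphericalCoxeterSystem

namespace SphericalCoxeterSystem

variable {n : ℕ} {cs : SphericalCoxeterSystem n} {v : ModelSpace n}

theorem exists_chamber_map_eq {v' : ModelSpace n} (hv : cs.Regular v) (hv' : cs.Regular v') :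
    ∃ w ∈ cs.Wbar, w '' cs.chamber v = cs.chamber v' := by
  have : Finite cs.Wbar := cs.finiteW
  obtain ⟨⟨w, hw⟩, hmax⟩ := Finite.exists_max
    fun w : cs.Wbar => ⟪v', (w : ModelSpace n ≃ᵢ ModelSpace n) v⟫
  refine ⟨w, hw, ?_⟩
  rw [image_chamber hw]
  refine (chamber_eq_of_pos_imp hv' fun β hβ hp => ?_).symm
  by_contra! hle
  have hneg : ⟪β, w v⟫ < 0 := lt_of_le_of_ne hle (hv.map hw β hβ)
  obtain ⟨r, hr, hrβ⟩ := exists_reflection_of_mem_roots hβ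
  have := hmax ⟨r * w, mul_mem hr hw⟩
  simp only [IsometryEquiv.mul_apply] at this
  rw [hrβ.2, inner_sub_right, inner_smul_right, real_inner_comm β v'] at this
  have : 0 < -⟪β, w v⟫ * ⟪β, v'⟫ := mul_pos (by linarith) hp
  nlinarith

theorem exists_add_smul_mem_chamber (x : ModelSpace n) :
    ∃ t : ℝ, 0 < t ∧ x + t • v ∈ cs.chamber v := by
  have hev : ∀ᶠ t : ℝ in Filter.atTop, ∀ β ∈ cs.roots, 0 < ⟪β, v⟫ → 0 ≤ ⟪β, x + t • v⟫ := by
    rw [Filter.eventually_all_finite cs.finite_roots]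
    intro β hβ
    filter_upwards [Filter.eventually_ge_atTop (-⟪β, x⟫ / ⟪β, v⟫)] with t ht hpos
    rw [inner_add_right, inner_smul_right]
    rw [div_le_iff₀ hpos] at ht
    linarith
  obtain ⟨t, ht, ht0⟩ := (hev.and (Filter.eventually_gt_atTop 0)).exists
  exact ⟨t, ht0, ht⟩

theorem eq_one_of_fix_chamber {w : ModelSpace n ≃ᵢ ModelSpace n} (hw : w ∈ cs.Wbar)
    (h : ∀ c ∈ cs.chamber v, w c = c) : w = 1 := by
  ext1 x
  obtain ⟨t, ht, hx⟩ := exists_add_smul_mem_chamber (cs := cs) (v := v) x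
  have := h _ hx
  rwa [Wbar_map_add hw, h _ (smul_mem_chamber self_mem_chamber ht.le), add_left_inj] at this

theorem mem_chamber_of_ray {x b : ModelSpace n}
    (h : ∀ t : ℝ, 0 ≤ t → t • x + b ∈ cs.chamber v) : x ∈ cs.chamber v := by
  intro α hα hp
  by_contra! hneg
  have hd : 0 < -⟪α, x⟫ := by linarith
  have := h ((|⟪α, b⟫| + 1) / (-⟪α, x⟫)) (by positivity) α hα hp
  rw [inner_add_right, inner_smul_right] at this
  have e : (|⟪α, b⟫| + 1) / (-⟪α, x⟫) * ⟪α, x⟫ = -(|⟪α, b⟫| + 1) := by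
    have : ⟪α, x⟫ ≠ 0 := hneg.ne
    field_simp
  rw [e] at this
  linarith [le_abs_self ⟪α, b⟫]

end SphericalCoxeterSystem

open SphericalCoxeterSystem

section Ray

variable {n : ℕ} {X : Type*} [MetricSpace X]

/-- The ray `t ↦ f (t • p)` is at bounded distance from the ray `t ↦ g (t • q)`. -/
def RayPar (f g : ModelSpace n → X) (p q : ModelSpace n) : Prop :=
  ∃ M, ∀ t : ℝ, 0 ≤ t → dist (f (t • p)) (g (t • q)) ≤ M

theorem RayPar.refl (f : ModelSpace n → X) (p : ModelSpace n) : RayPar f f p p :=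
  ⟨0, fun t _ => by simp⟩

theorem RayPar.symm {f g : ModelSpace n → X} {p q : ModelSpace n} (h : RayPar f g p q) :
    RayPar g f q p := by
  obtain ⟨M, h⟩ := h
  exact ⟨M, fun t ht => by rw [dist_comm]; exact h t ht⟩

theorem RayPar.trans {f g k : ModelSpace n → X} {p q r : ModelSpace n} (h : RayPar f g p q)
    (h' : RayPar g k q r) : RayPar f k p r := by
  obtain ⟨M, h⟩ := h
  obtain ⟨M', h'⟩ := h'
  exact ⟨M + M', fun t ht => (dist_triangle _ _ _).trans (add_le_add (h t ht) (h' t ht))⟩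

theorem rayPar_comp_left {cs : SphericalCoxeterSystem n} {w : ModelSpace n ≃ᵢ ModelSpace n}
    (hw : w ∈ cs.Wbar) {f g : ModelSpace n → X} {p q : ModelSpace n} :
    RayPar (f ∘ w) g p q ↔ RayPar f g (w p) q := by
  simp only [RayPar, Function.comp_apply, Wbar_map_smul hw]

theorem rayPar_comp_right {cs : SphericalCoxeterSystem n} {w : ModelSpace n ≃ᵢ ModelSpace n}
    (hw : w ∈ cs.Wbar) {f g : ModelSpace n → X} {p q : ModelSpace n} :
    RayPar f (g ∘ w) p q ↔ RayPar f g p (w q) := by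
  simp only [RayPar, Function.comp_apply, Wbar_map_smul hw]

/-- `f` and `g` map the rays from the origin in the directions of `Q` to rays at bounded
distance. -/
def ParOn (Q : Set (ModelSpace n)) (f g : ModelSpace n → X) : Prop :=
  ∀ p ∈ Q, RayPar f g p p

theorem ParOn.refl (Q : Set (ModelSpace n)) (f : ModelSpace n → X) : ParOn Q f f :=
  fun p _ => RayPar.refl f p

theorem ParOn.symm {Q : Set (ModelSpace n)} {f g : ModelSpace n → X} (h : ParOn Q f g) :
    ParOn Q g f := fun p hp => (h p hp).symm

theorem ParOn.trans {Q : Set (ModelSpace n)} {f g k : ModelSpace n → X} (h : ParOn Q f g)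
    (h' : ParOn Q g k) : ParOn Q f k := fun p hp => (h p hp).trans (h' p hp)

theorem ParOn.mono {Q Q' : Set (ModelSpace n)} {f g : ModelSpace n → X} (h : ParOn Q f g)
    (hQ : Q' ⊆ Q) : ParOn Q' f g := fun p hp => h p (hQ hp)

theorem parOn_of_eqOn {Q : Set (ModelSpace n)} {f g : ModelSpace n → X} (hf : Isometry f)
    (hg : Isometry g) (hQ : ∀ p ∈ Q, ∀ t : ℝ, 0 ≤ t → t • p ∈ Q) {x y : ModelSpace n}
    (h : ∀ c ∈ Q, f (x + c) = g (y + c)) : ParOn Q f g := by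
  refine fun p hp => ⟨‖x‖ + ‖y‖, fun t ht => ?_⟩
  refine (dist_triangle _ (f (x + t • p)) _).trans (add_le_add ?_ ?_)
  · rw [hf.dist_eq, dist_eq_norm, sub_add_cancel_right, norm_neg]
  · rw [h _ (hQ p hp t ht), hg.dist_eq, dist_eq_norm, add_sub_cancel_right]

theorem eq_of_forall_mul_sub_le {a b M : ℝ} (h : ∀ t : ℝ, 0 ≤ t → |t * a - t * b| ≤ M) :
    a = b := by
  by_contra hne
  have hpos : 0 < |a - b| := abs_pos.mpr (sub_ne_zero.mpr hne)
  have h1 := h ((|M| + 1) / |a - b|) (by positivity)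
  rw [← mul_sub, abs_mul, abs_of_nonneg (by positivity : 0 ≤ (|M| + 1) / |a - b|),
    div_mul_cancel₀ _ hpos.ne'] at h1
  linarith [le_abs_self M]

/-- Parallel charts identify directions in at most one way. -/
theorem ParOn.eq_of_rayPar {cs : SphericalCoxeterSystem n} {v : ModelSpace n}
    {f g : ModelSpace n → X} (hf : Isometry f) (hg : Isometry g)
    (h : ParOn (cs.chamber v) f g) {u u' : ModelSpace n} (hu : RayPar f g u u') : u = u' := by
  have hdist : ∀ c ∈ cs.chamber v, dist u c = dist u' c := fun c hc => by
    obtain ⟨M, hM⟩ := hu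
    obtain ⟨M', hM'⟩ := h c hc
    refine eq_of_forall_mul_sub_le (M := M + M') fun t ht => ?_
    have e : ∀ a b : ModelSpace n, t * dist a b = dist (t • a) (t • b) := fun a b => by
      rw [dist_smul₀, Real.norm_of_nonneg ht]
    rw [e, e, ← hf.dist_eq, ← hg.dist_eq]
    rw [← Real.dist_eq]
    refine (dist_dist_dist_le _ _ _ _).trans ?_
    exact add_le_add (hM t ht) (hM' t ht)
  have hnorm : ‖u‖ = ‖u'‖ := by
    simpa using hdist 0 zero_mem_chamber
  have hinner : ∀ c ∈ cs.chamber v, ⟪u, c⟫ = ⟪u', c⟫ := fun c hc => by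
    have h1 := hdist c hc
    rw [dist_eq_norm, dist_eq_norm] at h1
    have h2 := norm_sub_sq_real u c
    have h3 := norm_sub_sq_real u' c
    rw [h1, hnorm] at h2
    linarith
  obtain ⟨t, ht, hx⟩ := exists_add_smul_mem_chamber (cs := cs) (v := v) (u - u')
  have h1 := hinner _ hx
  have h2 := hinner _ (smul_mem_chamber self_mem_chamber ht.le)
  rw [inner_add_right, inner_add_right, h2, add_left_inj, ← sub_eq_zero, ← inner_sub_left,
    inner_self_eq_zero, sub_eq_zero] at h1
  exact h1

end Ray

namespace RBuilding

variable {n : ℕ} {cs : SphericalCoxeterSystem n} {v : ModelSpace n} {X : Type*} [MetricSpace X]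
  {Λ : Set X} (B : RBuilding cs X Λ)

theorem comp_mem {f : ModelSpace n → X} (hf : f ∈ B.charts) {u : ModelSpace n ≃ᵢ ModelSpace n}
    (hu : u ∈ cs.Wbar) : f ∘ u ∈ B.charts :=
  B.A1 f hf u (cs.mem_W_of_mem_Wbar hu)

theorem translate_mem {f : ModelSpace n → X} (hf : f ∈ B.charts) (b : ModelSpace n) :
    (fun y => f (y + b)) ∈ B.charts :=
  B.A1 f hf _ (cs.addRight_mem_W b)

theorem affine_mem {f : ModelSpace n → X} (hf : f ∈ B.charts)
    {u : ModelSpace n ≃ᵢ ModelSpace n} (hu : u ∈ cs.Wbar) (b : ModelSpace n) :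
    (fun y => f (u y + b)) ∈ B.charts :=
  B.comp_mem (B.translate_mem hf b) hu

theorem exists_transition {f g : ModelSpace n → X} (hf : f ∈ B.charts) (hg : g ∈ B.charts) :
    ∃ u ∈ cs.Wbar, ∃ b, ∀ x, f x ∈ range g → f x = g (u x + b) := by
  obtain ⟨-, -, w, hw, h⟩ := B.A2 f hf g hg
  obtain ⟨u, hu, b, hub⟩ := cs.exists_of_mem_W hw
  exact ⟨u, hu, b, fun x hx => by rw [h x hx, hub]⟩

theorem isSectorAt_iff (hv : cs.Regular v) {α : X} {F : Set X} :
    IsSectorAt cs B.charts α F ↔ ∃ f ∈ B.charts, f 0 = α ∧ F = f '' cs.chamber v := by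
  constructor
  · rintro ⟨f, hf, x, s, hs, rfl, rfl⟩
    obtain ⟨v', hv', rfl⟩ := isModelSector_iff.mp hs
    obtain ⟨w, hw, hwC⟩ := exists_chamber_map_eq hv hv'
    refine ⟨_, B.affine_mem hf hw x, by rw [Wbar_map_zero hw, zero_add], ?_⟩
    rw [← hwC]
    ext z
    constructor
    · rintro ⟨y, ⟨c, hc, hy⟩, rfl⟩
      exact ⟨c, hc, by simp only [hy, sub_add_cancel]⟩
    · rintro ⟨c, hc, rfl⟩
      exact ⟨w c + x, ⟨c, hc, by abel⟩, rfl⟩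
  · rintro ⟨f, hf, rfl, rfl⟩
    exact ⟨f, hf, 0, cs.chamber v, isModelSector_iff.mpr ⟨v, hv, by simp⟩, rfl, rfl⟩

theorem isSector_iff (hv : cs.Regular v) {F : Set X} :
    IsSector cs B.charts F ↔ ∃ f ∈ B.charts, F = f '' cs.chamber v := by
  constructor
  · rintro ⟨α, h⟩
    obtain ⟨f, hf, -, rfl⟩ := (B.isSectorAt_iff hv).mp h
    exact ⟨f, hf, rfl⟩
  · rintro ⟨f, hf, rfl⟩
    exact ⟨f 0, (B.isSectorAt_iff hv).mpr ⟨f, hf, rfl, rfl⟩⟩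

theorem exists_of_image_subset (hv : cs.Regular v) {f g : ModelSpace n → X} (hf : f ∈ B.charts)
    (hg : g ∈ B.charts) (h : g '' cs.chamber v ⊆ f '' cs.chamber v) :
    ∃ b, ∀ c ∈ cs.chamber v, f (b + c) ∈ g '' cs.chamber v := by
  obtain ⟨u, hu, b, hub⟩ := B.exists_transition hg hf
  have hmem : ∀ c ∈ cs.chamber v, u c + b ∈ cs.chamber v := fun c hc => by
    obtain ⟨d, hd, hdc⟩ := h (mem_image_of_mem g hc)
    have := hub c ⟨d, hdc⟩
    rw [← hdc] at this
    rwa [← (B.isom f hf).injective this]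
  have huv : u v ∈ cs.chamber v := mem_chamber_of_ray (b := b) fun t ht => by
    rw [← Wbar_map_smul hu]
    exact hmem _ (smul_mem_chamber self_mem_chamber ht)
  have hC := chamber_eq_of_mem hv (hv.map hu) huv
  refine ⟨b, fun c hc => ?_⟩
  rw [hC, ← image_chamber hu] at hc
  obtain ⟨d, hd, rfl⟩ := hc
  obtain ⟨d', -, hd'⟩ := h (mem_image_of_mem g hd)
  exact ⟨d, hd, by rw [hub d ⟨d', hd'⟩, add_comm]⟩

/-- Two sectors contain subsectors lying in a common apartment. -/
theorem exists_common_chart (hv : cs.Regular v) {f g : ModelSpace n → X} (hf : f ∈ B.charts)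
    (hg : g ∈ B.charts) :
    ∃ k ∈ B.charts, ∃ x, (∀ c ∈ cs.chamber v, k c = f (x + c)) ∧
      ∃ w ∈ cs.Wbar, ∃ y e, ∀ c ∈ cs.chamber v, k (w c + e) = g (y + c) := by
  obtain ⟨T₁, T₂, k, hk, hT₁, hT₂, h₁, h₂, hk₁, hk₂⟩ := B.A4 _ _
    ((B.isSector_iff hv).mpr ⟨f, hf, rfl⟩) ((B.isSector_iff hv).mpr ⟨g, hg, rfl⟩)
  obtain ⟨f₁, hf₁, rfl⟩ := (B.isSector_iff hv).mp hT₁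
  obtain ⟨g₁, hg₁, rfl⟩ := (B.isSector_iff hv).mp hT₂
  obtain ⟨x, hx⟩ := B.exists_of_image_subset hv hf hf₁ h₁
  obtain ⟨y, hy⟩ := B.exists_of_image_subset hv hg hg₁ h₂
  obtain ⟨u, hu, b, hub⟩ := B.exists_transition hf hk
  obtain ⟨w, hw, e, hwe⟩ := B.exists_transition hg hk
  have h1 : ∀ c ∈ cs.chamber v, k (u c + (u x + b)) = f (x + c) := fun c hc => by
    rw [hub _ (hk₁ (hx c hc)), Wbar_map_add hu]
    congr 1; abel
  have h2 : ∀ c ∈ cs.chamber v, k (w c + (w y + e)) = g (y + c) := fun c hc => by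
    rw [hwe _ (hk₂ (hy c hc)), Wbar_map_add hw]
    congr 1; abel
  refine ⟨_, B.affine_mem hk hu (u x + b), x, h1, u⁻¹ * w, mul_mem (inv_mem hu) hw, y,
    u⁻¹ ((w y + e) - (u x + b)), fun c hc => ?_⟩
  rw [← h2 c hc, Wbar_map_add hu, IsometryEquiv.mul_apply, apply_inv_apply, apply_inv_apply]
  congr 1; abel

theorem smul_mem_of_mem_chamber : ∀ p ∈ cs.chamber v, ∀ t : ℝ, 0 ≤ t → t • p ∈ cs.chamber v :=
  fun _ hp _ ht => smul_mem_chamber hp ht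

/-- Any two chambers at infinity lie in a common apartment at infinity. -/
theorem exists_parOn_parOn (hv : cs.Regular v) {f g : ModelSpace n → X} (hf : f ∈ B.charts)
    (hg : g ∈ B.charts) :
    ∃ k ∈ B.charts, ∃ w ∈ cs.Wbar, ParOn (cs.chamber v) k f ∧ ParOn (cs.chamber v) (k ∘ w) g := by
  obtain ⟨k, hk, x, hx, w, hw, y, e, hwe⟩ := B.exists_common_chart hv hf hg
  refine ⟨k, hk, w, hw, parOn_of_eqOn (x := 0) (y := x) (B.isom k hk) (B.isom f hf)
    smul_mem_of_mem_chamber fun c hc => by rw [zero_add, hx c hc],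
    parOn_of_eqOn (x := w⁻¹ e) (y := y) (B.isom _ (B.comp_mem hk hw)) (B.isom g hg)
    smul_mem_of_mem_chamber fun c hc => ?_⟩
  rw [Function.comp_apply, Wbar_map_add hw, apply_inv_apply, add_comm, hwe c hc]

theorem eq_one_of_parOn_comp {k : ModelSpace n → X} (hk : k ∈ B.charts)
    {w : ModelSpace n ≃ᵢ ModelSpace n} (hw : w ∈ cs.Wbar)
    (h : ParOn (cs.chamber v) (k ∘ w) k) : w = 1 :=
  eq_one_of_fix_chamber (v := v) hw fun c hc =>
    (ParOn.refl (cs.chamber v) k).eq_of_rayPar (B.isom k hk) (B.isom k hk)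
      ((rayPar_comp_left hw).mp (h c hc))

theorem exists_eq_of_parOn (hv : cs.Regular v) {f g : ModelSpace n → X} (hf : f ∈ B.charts)
    (hg : g ∈ B.charts) (h : ParOn (cs.chamber v) f g) :
    ∃ x e, ∀ c ∈ cs.chamber v, f (x + c) = g (e + c) := by
  obtain ⟨k, hk, x, hx, w, hw, y, e, hwe⟩ := B.exists_common_chart hv hf hg
  have hkf : ParOn (cs.chamber v) k f :=
    parOn_of_eqOn (x := 0) (y := x) (B.isom k hk) (B.isom f hf)
    smul_mem_of_mem_chamber fun c hc => by rw [zero_add, hx c hc]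
  have hkg : ParOn (cs.chamber v) (k ∘ w) g :=
    parOn_of_eqOn (x := w⁻¹ e) (y := y) (B.isom _ (B.comp_mem hk hw)) (B.isom g hg)
    smul_mem_of_mem_chamber fun c hc => by
      rw [Function.comp_apply, Wbar_map_add hw, apply_inv_apply, add_comm, hwe c hc]
  obtain rfl := B.eq_one_of_parOn_comp hk hw (hkg.trans (h.symm.trans hkf.symm))
  obtain ⟨t, ht, he⟩ := exists_add_smul_mem_chamber (cs := cs) (v := v) e
  have hv' : t • v ∈ cs.chamber v := smul_mem_chamber self_mem_chamber ht.le
  refine ⟨x + (e + t • v), y + t • v, fun c hc => ?_⟩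
  rw [add_assoc, ← hx _ (add_mem_chamber he hc), add_assoc y, ← hwe _ (add_mem_chamber hv' hc)]
  congr 1
  change e + t • v + c = t • v + c + e
  abel

/-- Charts with parallel chambers agree up to a translation wherever their images meet, and
the region where they meet is stable under the chamber. -/
theorem exists_translation_of_parOn (hv : cs.Regular v) {f g : ModelSpace n → X}
    (hf : f ∈ B.charts) (hg : g ∈ B.charts) (h : ParOn (cs.chamber v) f g) :
    ∃ b, (∀ z, f z ∈ range g → f z = g (z + b)) ∧ (∃ x, ∀ c ∈ cs.chamber v, f (x + c) ∈ range g) ∧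
      ∀ z, f z ∈ range g → ∀ c ∈ cs.chamber v, f (z + c) ∈ range g := by
  obtain ⟨x, e, hxe⟩ := B.exists_eq_of_parOn hv hf hg h
  obtain ⟨u, hu, b, hub⟩ := B.exists_transition hf hg
  have hval : ∀ c ∈ cs.chamber v, u (x + c) + b = e + c := fun c hc =>
    (B.isom g hg).injective (by rw [← hub _ ⟨_, (hxe c hc).symm⟩, hxe c hc])
  have hu1 : u = 1 := eq_one_of_fix_chamber (v := v) hu fun c hc => by
    have h1 := hval c hc
    have h2 := hval 0 zero_mem_chamber
    rw [Wbar_map_add hu] at h1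
    rw [add_zero, add_zero] at h2
    rw [← h2, add_right_comm, add_assoc, add_assoc, add_right_inj, add_right_inj] at h1
    exact h1
  subst hu1
  refine ⟨b, hub, ⟨x, fun c hc => ⟨_, (hxe c hc).symm⟩⟩, fun z hz c hc => ?_⟩
  obtain ⟨hclosed, hconv, -⟩ := B.A2 f hf g hg
  exact hconv.add_mem_of_ray hclosed (x := x)
    (fun t ht => ⟨_, (hxe _ (smul_mem_chamber hc ht)).symm⟩) hz

theorem eqOn_chamber_of_parOn (hv : cs.Regular v) {f g : ModelSpace n → X} (hf : f ∈ B.charts)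
    (hg : g ∈ B.charts) (h : ParOn (cs.chamber v) f g) {x y : ModelSpace n} (h0 : f x = g y) :
    ∀ c ∈ cs.chamber v, f (x + c) = g (y + c) := by
  obtain ⟨b, hb, -, hs⟩ := B.exists_translation_of_parOn hv hf hg h
  intro c hc
  have hx : f x ∈ range g := ⟨y, h0.symm⟩
  rw [hb _ (hs x hx c hc)]
  have : x + b = y := (B.isom g hg).injective (by rw [← hb x hx, h0])
  rw [← this]
  congr 1; abel

theorem par_of_parOn (hv : cs.Regular v) {f g : ModelSpace n → X} (hf : f ∈ B.charts)
    (hg : g ∈ B.charts) (h : ParOn (cs.chamber v) f g) :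
    Par (f '' cs.chamber v) (g '' cs.chamber v) := by
  obtain ⟨x, e, hxe⟩ := B.exists_eq_of_parOn hv hf hg h
  have key : ∀ c ∈ cs.chamber v, edist (f c) (g c) ≤ ENNReal.ofReal (‖x‖ + ‖e‖) := fun c hc => by
    rw [edist_dist]
    refine ENNReal.ofReal_le_ofReal ((dist_triangle _ (f (x + c)) _).trans (add_le_add ?_ ?_))
    · rw [(B.isom f hf).dist_eq, dist_eq_norm, sub_add_cancel_right, norm_neg]
    · rw [hxe c hc, (B.isom g hg).dist_eq, dist_eq_norm, add_sub_cancel_right]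
  refine ne_top_of_le_ne_top (ENNReal.ofReal_ne_top (r := ‖x‖ + ‖e‖))
    (Metric.hausdorffEDist_le_of_mem_edist ?_ ?_)
  · rintro _ ⟨c, hc, rfl⟩
    exact ⟨g c, mem_image_of_mem g hc, key c hc⟩
  · rintro _ ⟨c, hc, rfl⟩
    exact ⟨f c, mem_image_of_mem f hc, by rw [edist_comm]; exact key c hc⟩

theorem _root_.Par.symm {S T : Set X} (h : Par S T) : Par T S := by
  change Metric.hausdorffEDist T S ≠ ⊤
  rw [Metric.hausdorffEDist_comm]
  exact h

theorem _root_.Par.trans {S T U : Set X} (h : Par S T) (h' : Par T U) : Par S U :=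
  ne_top_of_le_ne_top (ENNReal.add_ne_top.mpr ⟨h, h'⟩) Metric.hausdorffEDist_triangle

theorem chamber_eq_of_par {k : ModelSpace n → X} (hk : Isometry k) {v' : ModelSpace n}
    (hv : cs.Regular v) (hv' : cs.Regular v')
    (h : Par (k '' cs.chamber v) (k '' cs.chamber v')) : cs.chamber v = cs.chamber v' := by
  change Metric.hausdorffEDist _ _ ≠ ⊤ at h
  rw [Metric.hausdorffEDist_image hk] at h
  refine (chamber_eq_of_mem hv' hv fun α hα hp => ?_).symm
  by_contra! hneg
  have hα1 := norm_of_mem_roots hα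
  obtain ⟨R, hR⟩ : ∃ R : ℝ, ∀ c ∈ cs.chamber v, ∃ d ∈ cs.chamber v', dist c d ≤ R := by
    refine ⟨(Metric.hausdorffEDist (cs.chamber v) (cs.chamber v') + 1).toReal, fun c hc => ?_⟩
    obtain ⟨d, hd, hcd⟩ := Metric.exists_edist_lt_of_hausdorffEDist_lt hc
      (ENNReal.lt_add_right h one_ne_zero)
    refine ⟨d, hd, ?_⟩
    rw [dist_edist]
    exact ENNReal.toReal_mono (ENNReal.add_ne_top.mpr ⟨h, ENNReal.one_ne_top⟩) hcd.le
  have hd0 : 0 < -⟪α, v⟫ := by linarith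
  have hpos : 0 ≤ (|R| + 1) / (-⟪α, v⟫) := by positivity
  obtain ⟨d, hd, hcd⟩ := hR _ (smul_mem_chamber self_mem_chamber hpos)
  have h1 := hd α hα hp
  have h2 := real_inner_le_norm α (d - ((|R| + 1) / (-⟪α, v⟫)) • v)
  rw [hα1, one_mul, ← dist_eq_norm, dist_comm, inner_sub_right, inner_smul_right] at h2
  have e : (|R| + 1) / (-⟪α, v⟫) * ⟪α, v⟫ = -(|R| + 1) := by
    have : ⟪α, v⟫ ≠ 0 := hneg.ne
    field_simp
  rw [e] at h2
  linarith [le_abs_self R]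

theorem exists_parOn_of_par (hv : cs.Regular v) {f g : ModelSpace n → X} (hf : f ∈ B.charts)
    (hg : g ∈ B.charts) (h : Par (f '' cs.chamber v) (g '' cs.chamber v)) :
    ∃ w ∈ cs.Wbar, cs.chamber (w v) = cs.chamber v ∧ ParOn (cs.chamber v) f (g ∘ w) := by
  obtain ⟨k, hk, w, hw, hkf, hkg⟩ := B.exists_parOn_parOn hv hf hg
  have h1 := B.par_of_parOn hv hk hf hkf
  have h2 := B.par_of_parOn hv (B.comp_mem hk hw) hg hkg
  have h3 := (h1.trans h).trans h2.symm
  rw [image_comp, image_chamber hw] at h3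
  have hC := chamber_eq_of_par (B.isom k hk) hv (hv.map hw) h3
  refine ⟨w⁻¹, inv_mem hw, ?_, fun p hp => ?_⟩
  · have : (⇑w⁻¹ ∘ ⇑w) = id := funext (inv_apply_apply w)
    rw [← image_chamber (inv_mem hw)]
    conv_lhs => rw [hC, ← image_chamber hw, ← image_comp, this, image_id]
  · refine (hkf p hp).symm.trans ?_
    have hp' : w⁻¹ p ∈ cs.chamber v := by
      rw [← map_mem_chamber_iff hw, apply_inv_apply, ← hC]
      exact hp
    have := hkg _ hp'
    rw [rayPar_comp_left hw, apply_inv_apply] at this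
    exact (rayPar_comp_right (inv_mem hw)).mpr this

end RBuilding

theorem image_setOf_mem_range {A X : Type*} (f g : A → X) :
    f '' {z | f z ∈ range g} = range f ∩ range g := by
  ext x
  constructor
  · rintro ⟨z, hz, rfl⟩
    exact ⟨mem_range_self z, hz⟩
  · rintro ⟨⟨z, rfl⟩, hz⟩
    exact ⟨z, hz, rfl⟩

namespace SphericalCoxeterSystem

variable {n : ℕ} {cs : SphericalCoxeterSystem n} {v : ModelSpace n}

theorem Simple.mul_self {s : ModelSpace n ≃ᵢ ModelSpace n} {α : ModelSpace n}
    (h : cs.Simple v s α) : s * s = 1 := h.refl.mul_self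

theorem Simple.inv_eq {s : ModelSpace n ≃ᵢ ModelSpace n} {α : ModelSpace n}
    (h : cs.Simple v s α) : s⁻¹ = s := inv_eq_of_mul_eq_one_left h.mul_self

theorem IsWord.prod_reverse {l : List (ModelSpace n ≃ᵢ ModelSpace n)} (h : cs.IsWord v l) :
    l.reverse.prod = l.prod⁻¹ := by
  rw [List.prod_inv_reverse]
  congr 2
  conv_lhs => rw [← List.map_id l]
  refine List.map_congr_left fun s hs => ?_
  obtain ⟨α, hα⟩ := h s hs
  rw [hα.inv_eq, id]

theorem IsWord.reverse {l : List (ModelSpace n ≃ᵢ ModelSpace n)} (h : cs.IsWord v l) :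
    cs.IsWord v l.reverse := fun s hs => h s (List.mem_reverse.mp hs)

theorem Opp.prod_ne {w : ModelSpace n ≃ᵢ ModelSpace n} (hw : cs.Opp v w)
    {l : List (ModelSpace n ≃ᵢ ModelSpace n)} (h : cs.IsWord v l)
    (hlen : l.length < {α | α ∈ cs.roots ∧ 0 < ⟪α, v⟫}.ncard)
    {l' : List (ModelSpace n ≃ᵢ ModelSpace n)} (hl : l'.Sublist l) : l'.prod ≠ w := by
  rintro rfl
  have := (h.sublist hl).ncard_le
  rw [hw.ncard] at this
  have := hl.length_le
  omega

end SphericalCoxeterSystem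

section

variable {n : ℕ} {cs : SphericalCoxeterSystem n} {v : ModelSpace n} {X : Type*} [MetricSpace X]

theorem ParOn.comp {w : ModelSpace n ≃ᵢ ModelSpace n} (hw : w ∈ cs.Wbar)
    {Q Q' : Set (ModelSpace n)} {f g : ModelSpace n → X} (h : ParOn Q f g)
    (hQ : ∀ p ∈ Q', w p ∈ Q) : ParOn Q' (f ∘ w) (g ∘ w) := fun p hp =>
  (rayPar_comp_left hw).mpr ((rayPar_comp_right hw).mpr (h _ (hQ p hp)))

theorem parOn_panel_comp {s : ModelSpace n ≃ᵢ ModelSpace n} {α : ModelSpace n}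
    (hs : cs.Simple v s α) (f : ModelSpace n → X) : ParOn (cs.panel v s) (f ∘ s) f :=
  fun p hp => (rayPar_comp_left hs.mem).mpr (by rw [hp.2]; exact RayPar.refl f p)

theorem panel_subset {s : ModelSpace n ≃ᵢ ModelSpace n} : cs.panel v s ⊆ cs.chamber v :=
  fun _ hp => hp.1

end

namespace RBuilding

variable {n : ℕ} {cs : SphericalCoxeterSystem n} {v : ModelSpace n} {X : Type*} [MetricSpace X]
  {Λ : Set X} (B : RBuilding cs X Λ) {s : ModelSpace n ≃ᵢ ModelSpace n} {α : ModelSpace n}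

theorem eq_of_parOn_comp {k k' : ModelSpace n → X} (hk : k ∈ B.charts)
    (hk' : k' ∈ B.charts) {w w' : ModelSpace n ≃ᵢ ModelSpace n} (hw : w ∈ cs.Wbar)
    (hw' : w' ∈ cs.Wbar) (hkk : ParOn (cs.chamber v) k k')
    (h : ParOn (cs.chamber v) (k ∘ w) (k' ∘ w')) : w = w' := by
  have : w⁻¹ * w' = 1 := eq_one_of_fix_chamber (v := v) (mul_mem (inv_mem hw) hw') fun p hp => by
    have := hkk.eq_of_rayPar (B.isom k hk) (B.isom k' hk')
      ((rayPar_comp_left hw).mp ((rayPar_comp_right hw').mp (h p hp)))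
    rw [IsometryEquiv.mul_apply, ← this, inv_apply_apply]
  rwa [inv_mul_eq_one] at this

theorem eq_or_eq_of_parOn_panel (hs : cs.Simple v s α) {k k' : ModelSpace n → X}
    (hk : k ∈ B.charts) (hk' : k' ∈ B.charts) {w w' : ModelSpace n ≃ᵢ ModelSpace n}
    (hw : w ∈ cs.Wbar) (hw' : w' ∈ cs.Wbar) (hkk : ParOn (cs.chamber v) k k')
    (h : ParOn (cs.panel v s) (k ∘ w) (k' ∘ w')) : w' = w ∨ w' = w * s := by
  have := hs.eq_one_or_eq_of_fix_panel (mul_mem (inv_mem hw) hw') fun p hp => by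
    have := hkk.eq_of_rayPar (B.isom k hk) (B.isom k' hk')
      ((rayPar_comp_left hw).mp ((rayPar_comp_right hw').mp (h p hp)))
    rw [IsometryEquiv.mul_apply, ← this, inv_apply_apply]
  refine this.imp (fun h => (inv_mul_eq_one.mp h).symm) fun h => ?_
  rw [← h, mul_inv_cancel_left]

theorem exists_sublist_of_panel (hv : cs.Regular v) (hs : cs.Simple v s α)
    {l : List (ModelSpace n ≃ᵢ ModelSpace n)} (hl : cs.IsWord v l) {k z : ModelSpace n → X}
    (hk : k ∈ B.charts) (hz : z ∈ B.charts) (hp : ParOn (cs.panel v s) (k ∘ l.prod) z)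
    (hne : ¬ ParOn (cs.chamber v) (k ∘ l.prod) z) :
    ∃ l' : List (ModelSpace n ≃ᵢ ModelSpace n), l'.Sublist l ∧ ∃ m ∈ B.charts,
      ParOn (cs.chamber v) m k ∧ ParOn (cs.chamber v) (m ∘ (l'.prod * s)) z := by
  induction l generalizing k with
  | nil =>
    obtain ⟨m, hm, w, hw, h1, h2⟩ := B.exists_parOn_parOn hv hk hz
    refine ⟨[], List.Sublist.refl _, m, hm, h1, ?_⟩
    rcases B.eq_or_eq_of_parOn_panel hs hk hm (one_mem _) hw h1.symm
      (hp.trans (h2.mono panel_subset).symm) with rfl | rfl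
    · exact absurd (h1.symm.trans h2) hne
    · exact h2
  | cons t l ih =>
    obtain ⟨⟨β, ht⟩, hl⟩ := isWord_cons.mp hl
    obtain ⟨l', hl', k', hk', h1, h2⟩ := ih hl (B.comp_mem hk ht.mem) hp hne
    obtain ⟨m, hm, w, hw, h3, h4⟩ := B.exists_parOn_parOn hv hk hz
    have hw' : l'.prod * s ∈ cs.Wbar := mul_mem (hl.sublist hl').prod_mem hs.mem
    set w' := l'.prod * s with hdef
    have e1 : (k' ∘ ⇑w') ∘ ⇑w'⁻¹ = k' := funext fun x => congrArg k' (apply_inv_apply w' x)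
    have e2 : (m ∘ ⇑w) ∘ ⇑w⁻¹ = m := funext fun x => congrArg m (apply_inv_apply w x)
    rcases B.eq_or_eq_of_parOn_panel ht (B.comp_mem hk' hw') (B.comp_mem hm hw) (inv_mem hw')
      (inv_mem hw) (h2.trans h4.symm) (by
        rw [e1, e2]
        exact (h1.mono panel_subset).trans ((parOn_panel_comp ht k).trans
          (h3.mono panel_subset).symm)) with h | h
    · rw [inv_inj] at h
      exact ⟨l', hl'.cons t, m, hm, h3, by rw [← hdef, ← h]; exact h4⟩
    · refine ⟨t :: l', hl'.cons_cons t, m, hm, h3, ?_⟩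
      rw [List.prod_cons, mul_assoc, ← hdef]
      have : w = t * w' := by rw [← inv_inj, h, mul_inv_rev t w', ht.inv_eq]
      exact this ▸ h4

/-- Uniqueness of the projection to a panel at infinity. -/
theorem parOn_of_panel (hv : cs.Regular v) (hs : cs.Simple v s α)
    {l : List (ModelSpace n ≃ᵢ ModelSpace n)} (hl : cs.IsWord v l)
    (hlen : l.length < {α | α ∈ cs.roots ∧ 0 < ⟪α, v⟫}.ncard) (hopp : cs.Opp v (l.prod * s))
    {k k' : ModelSpace n → X} (hk : k ∈ B.charts) (hk' : k' ∈ B.charts)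
    (h : ParOn (cs.chamber v) k k')
    (hp : ParOn (cs.panel v s) (k ∘ l.prod) (k' ∘ l.prod)) :
    ParOn (cs.chamber v) (k ∘ l.prod) (k' ∘ l.prod) := by
  by_contra hne
  obtain ⟨l', hl', m, hm, h1, h2⟩ := B.exists_sublist_of_panel hv hs hl hk
    (B.comp_mem hk' hl.prod_mem) hp hne
  have := B.eq_of_parOn_comp hm hk' (mul_mem (hl.sublist hl').prod_mem hs.mem) hl.prod_mem
    (h1.trans h) h2
  refine hopp.prod_ne hl hlen hl' ?_
  rw [← this, mul_assoc, hs.mul_self, mul_one]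

/-- A half-apartment at infinity and a chamber adjacent to it along a boundary panel lie in a
common apartment at infinity. -/
theorem exists_half_extension (hv : cs.Regular v) (hs : cs.Simple v s α)
    {l : List (ModelSpace n ≃ᵢ ModelSpace n)} (hl : cs.IsWord v l)
    (hlen : l.length < {α | α ∈ cs.roots ∧ 0 < ⟪α, v⟫}.ncard) (hopp : cs.Opp v (s * l.prod))
    {a d : ModelSpace n → X} (ha : a ∈ B.charts) (hd : d ∈ B.charts)
    (hp : ParOn (cs.panel v s) a d) (hne : ¬ ParOn (cs.chamber v) a d) :
    ∃ b ∈ B.charts, ParOn (cs.chamber v) b a ∧ ParOn (cs.chamber v) (b ∘ s) d ∧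
      ParOn (cs.chamber v) (b ∘ l.prod) (a ∘ l.prod) := by
  have hw := hl.prod_mem
  have hrev := hl.prod_reverse
  have hopp' : cs.Opp v (l.reverse.prod * s) := by
    have := hopp.inv hv
    rwa [mul_inv_rev, hs.inv_eq, ← hrev] at this
  have hlen' : l.reverse.length < {α | α ∈ cs.roots ∧ 0 < ⟪α, v⟫}.ncard := by
    rwa [List.length_reverse]
  have hcancel : ∀ k : ModelSpace n → X, (k ∘ ⇑l.prod) ∘ ⇑l.reverse.prod = k := fun k =>
    funext fun x => by rw [hrev]; exact congrArg k (apply_inv_apply _ x)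
  have hcancel' : ∀ k : ModelSpace n → X, (k ∘ ⇑l.reverse.prod) ∘ ⇑l.prod = k := fun k =>
    funext fun x => by rw [hrev]; exact congrArg k (inv_apply_apply _ x)
  have hrw := hl.reverse.prod_mem
  obtain ⟨k, hk, δ, hδ, h1, h2⟩ := B.exists_parOn_parOn hv (B.comp_mem ha hw) hd
  have hδ' := B.eq_or_eq_of_parOn_panel hs (B.comp_mem ha hw) hk hrw hδ h1.symm (by
    rw [hcancel]
    exact hp.trans (h2.mono panel_subset).symm)
  rcases hδ' with rfl | rfl
  · refine absurd ?_ hne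
    have := B.parOn_of_panel hv hs hl.reverse hlen' hopp' (B.comp_mem ha hw) hk h1.symm (by
      rw [hcancel]
      exact hp.trans (h2.mono panel_subset).symm)
    rw [hcancel] at this
    exact this.trans h2
  · refine ⟨k ∘ l.reverse.prod, B.comp_mem hk hrw, ?_, h2, ?_⟩
    · have := B.parOn_of_panel hv hs hl.reverse hlen' hopp' hk (B.comp_mem ha hw) h1 (by
        rw [hcancel]
        exact (parOn_panel_comp hs _).symm.trans ((h2.mono panel_subset).trans hp.symm))
      rwa [hcancel] at this
    · rw [hcancel']
      exact h1

theorem isHalfApartment_of_eq_half (hα : α ∈ cs.roots) {f g : ModelSpace n → X}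
    (hf : f ∈ B.charts) {κ : ℝ} (h : {z | f z ∈ range g} = {z | κ ≤ ⟪α, z⟫}) :
    IsHalfApartment cs B.charts (range f ∩ range g) := by
  refine ⟨f, hf, _, _, isModelHalf_of_root hα (κ • α), ?_⟩
  rw [← image_setOf_mem_range, h]
  congr 1
  ext z
  rw [mem_ofPred_eq, mem_ofPred_eq, inner_sub_right, inner_smul_right,
    inner_self_of_mem_roots hα, mul_one, sub_nonneg]

/-- Two charts whose chambers at infinity agree on a half-apartment meet in a half-apartment,
or have the same image. -/
theorem eq_univ_or_eq_half_of_parOn (hv : cs.Regular v) (hs : cs.Simple v s α)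
    {w : ModelSpace n ≃ᵢ ModelSpace n} (hw : w ∈ cs.Wbar) (hopp : cs.Opp v (s * w))
    {f g : ModelSpace n → X} (hf : f ∈ B.charts) (hg : g ∈ B.charts)
    (h : ParOn (cs.chamber v) f g) (h' : ParOn (cs.chamber v) (f ∘ w) (g ∘ w)) :
    {z | f z ∈ range g} = univ ∨ ∃ κ : ℝ, {z | f z ∈ range g} = {z | κ ≤ ⟪α, z⟫} := by
  obtain ⟨hclosed, hconv, -⟩ := B.A2 f hf g hg
  obtain ⟨-, -, ⟨x, hx⟩, -⟩ := B.exists_translation_of_parOn hv hf hg h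
  obtain ⟨-, -, ⟨y, hy⟩, -⟩ := B.exists_translation_of_parOn hv (B.comp_mem hf hw)
    (B.comp_mem hg hw) h'
  refine hs.eq_univ_or_eq_half hconv hclosed (x := x) (y := w y) hx fun c hc => ?_
  have h1 : w⁻¹ (-(s c)) ∈ cs.chamber v := by
    have e : (s * w) (w⁻¹ (-(s c))) = -c := by
      rw [IsometryEquiv.mul_apply, apply_inv_apply, Wbar_map_neg hs.mem, hs.refl.apply_apply]
    have := hopp.mem_chamber_iff hv (-(w⁻¹ (-(s c))))
    rw [Wbar_map_neg hopp.1, e, neg_neg, neg_neg] at this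
    exact this.mp hc
  obtain ⟨z, hz⟩ := hy _ h1
  refine ⟨w z, ?_⟩
  rw [Function.comp_apply, Function.comp_apply, Wbar_map_add hw, apply_inv_apply,
    ← sub_eq_add_neg] at hz
  exact hz

end RBuilding

namespace RBuilding

variable {n : ℕ} {cs : SphericalCoxeterSystem n} {v : ModelSpace n} {X : Type*} [MetricSpace X]
  {Λ : Set X} (B : RBuilding cs X Λ) {s : ModelSpace n ≃ᵢ ModelSpace n} {α : ModelSpace n}

theorem parOn_univ (hv : cs.Regular v) {f g : ModelSpace n → X} (hf : f ∈ B.charts)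
    (hg : g ∈ B.charts) (h : ParOn (cs.chamber v) f g) (hfg : ∀ z, f z ∈ range g) :
    ParOn univ f g := by
  obtain ⟨b, hb, -, -⟩ := B.exists_translation_of_parOn hv hf hg h
  refine fun p _ => ⟨‖b‖, fun t _ => ?_⟩
  rw [hb _ (hfg _), (B.isom g hg).dist_eq, dist_eq_norm, add_sub_cancel_left]

/-- An apartment is the union of two half-apartments, each lying in a common apartment with
the neighbouring chamber at infinity `k ∘ s`. -/
theorem exists_halves (hv : cs.Regular v) (hs : cs.Simple v s α) {k a : ModelSpace n → X}
    (hk : k ∈ B.charts) (ha : a ∈ B.charts) (hka : ParOn (cs.chamber v) k a) :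
    ∃ b ∈ B.charts, ∃ c ∈ B.charts, ∃ κ : ℝ, ParOn (cs.chamber v) b (k ∘ s) ∧
      ParOn (cs.chamber v) c (k ∘ s) ∧ (∀ z, κ ≤ ⟪α, z⟫ → a z ∈ range b) ∧
      ∀ z, ⟪α, z⟫ ≤ κ → a z ∈ range c := by
  have hrange : ∀ f : ModelSpace n → X, range (f ∘ s) = range f := fun f =>
    s.surjective.range_comp f
  have hss : ∀ f : ModelSpace n → X, (f ∘ s) ∘ s = f := fun f =>
    funext fun x => congrArg f (hs.refl.apply_apply x)
  have hks := B.comp_mem hk hs.mem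
  have has := B.comp_mem ha hs.mem
  by_cases htriv : ParOn (cs.chamber v) (a ∘ s) (k ∘ s)
  · exact ⟨a ∘ s, has, a ∘ s, has, 0, htriv, htriv, fun z _ => by rw [hrange]; exact mem_range_self z,
      fun z _ => by rw [hrange]; exact mem_range_self z⟩
  have hs1 : s ≠ 1 := by
    rintro rfl
    have h1 := congrArg (⟪·, v⟫) hs.apply_root
    simp only [IsometryEquiv.coe_one, id, inner_neg_left] at h1
    linarith [hs.pos]
  have hane : ¬ ParOn (cs.chamber v) a (k ∘ s) := fun h =>
    hs1 (B.eq_one_of_parOn_comp hk hs.mem (h.symm.trans hka.symm))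
  have hpa : ParOn (cs.panel v s) a (k ∘ s) :=
    (hka.mono panel_subset).symm.trans (parOn_panel_comp hs k).symm
  have hpas : ParOn (cs.panel v s) (a ∘ s) (k ∘ s) := (parOn_panel_comp hs a).trans hpa
  obtain ⟨l, hl, hopp, hlen⟩ := hs.exists_opp_word hv
  have hw := hl.prod_mem
  obtain ⟨b, hb, hba, hbd, hbw⟩ := B.exists_half_extension hv hs hl hlen hopp ha hks hpa hane
  obtain ⟨c, hc, hca, hcd, hcw⟩ := B.exists_half_extension hv hs hl hlen hopp has hks hpas htriv
  have hbs := B.comp_mem hb hs.mem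
  have hcs := B.comp_mem hc hs.mem
  obtain hab | ⟨κ, hκ⟩ := B.eq_univ_or_eq_half_of_parOn hv hs hw hopp ha hb hba.symm hbw.symm
  · refine absurd ((ParOn.comp hs.mem ?_ fun _ _ => mem_univ _).trans hbd) htriv
    exact B.parOn_univ hv ha hb hba.symm fun z => hab.ge (mem_univ z)
  obtain hac | ⟨μ, hμ⟩ := B.eq_univ_or_eq_half_of_parOn hv hs hw hopp has hc hca.symm hcw.symm
  · have := (B.parOn_univ hv has hc hca.symm fun z => hac.ge (mem_univ z)).comp hs.mem
      (Q' := cs.chamber v) fun _ _ => mem_univ _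
    rw [hss] at this
    exact absurd (this.trans hcd) hane
  have hbc : ParOn (cs.chamber v) ((b ∘ s) ∘ l.prod) ((c ∘ s) ∘ l.prod) := by
    have ht := hs.conj_opp hv hopp
    set t := (s * l.prod)⁻¹ * s * (s * l.prod) with htdef
    have e1 : l.prod * t = s * l.prod := by
      rw [htdef, mul_inv_rev, hs.inv_eq]; group
      rw [hs.mul_self, one_mul]
    have e2 : s * l.prod * t = l.prod := by
      rw [mul_assoc, e1, ← mul_assoc, hs.mul_self, one_mul]
    have hsw : ∀ f : ModelSpace n → X,
        ParOn (cs.panel v t) (f ∘ l.prod) ((f ∘ s) ∘ l.prod) := fun f => by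
      have := parOn_panel_comp ht (f ∘ ⇑(s * l.prod))
      have e : (f ∘ ⇑(s * l.prod)) ∘ ⇑t = f ∘ ⇑(s * l.prod * t) := rfl
      rw [e, e2] at this
      exact this
    refine B.parOn_of_panel hv ht hl hlen (e1 ▸ hopp) hbs hcs (hbd.trans hcd.symm) ?_
    exact ((hsw b).symm.trans (hbw.mono panel_subset)).trans ((hsw a).trans
      ((hcw.mono panel_subset).symm.trans (hsw c)))
  have hμ' : ∀ z, a z ∈ range c ↔ ⟪α, z⟫ ≤ -μ := fun z => by
    have := Set.ext_iff.mp hμ (s z)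
    rw [mem_ofPred_eq, mem_ofPred_eq, Function.comp_apply, hs.refl.apply_apply,
      ← hs.refl.inner_comm, hs.apply_root, inner_neg_left] at this
    rw [this, le_neg]
  have hκ' : ∀ z, a z ∈ range b ↔ κ ≤ ⟪α, z⟫ := Set.ext_iff.mp hκ
  have hle : κ ≤ -μ := by
    obtain huniv | ⟨ν, hν⟩ := B.eq_univ_or_eq_half_of_parOn hv hs hw hopp hbs hcs
      (hbd.trans hcd.symm) hbc
    · exfalso
      set z := (max κ (-μ) + 1) • α
      have hz : ⟪α, z⟫ = max κ (-μ) + 1 := by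
        rw [inner_smul_right, inner_self_of_mem_roots hs.root, mul_one]
      obtain ⟨y, hy⟩ := (hκ' z).mpr (by rw [hz]; linarith [le_max_left κ (-μ)])
      have h1 : (b ∘ s) (s y) ∈ range (c ∘ s) := huniv.ge (mem_univ _)
      rw [Function.comp_apply, hs.refl.apply_apply, hy, hrange, hμ', hz] at h1
      linarith [le_max_right κ (-μ)]
    · have h1 := B.isHalfApartment_of_eq_half hs.root ha hκ
      have h2 := B.isHalfApartment_of_eq_half hs.root hbs hν
      have h3 := B.isHalfApartment_of_eq_half hs.root has hμ
      rw [hrange, hrange] at h2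
      rw [hrange] at h3
      obtain ⟨_, ⟨⟨z, rfl⟩, hzb⟩, hzc⟩ := B.A5 a ha b hb c hc h1 h2 h3
      exact ((hκ' z).mp hzb).trans ((hμ' z).mp hzc)
  refine ⟨b ∘ s, hbs, c ∘ s, hcs, κ, hbd, hcd, fun z hz => ?_, fun z hz => ?_⟩
  · rw [hrange]
    exact (hκ' z).mpr hz
  · rw [hrange]
    exact (hμ' z).mpr (hz.trans hle)

end RBuilding

namespace RBuilding

variable {n : ℕ} {cs : SphericalCoxeterSystem n} {v : ModelSpace n} {X : Type*} [MetricSpace X]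
  {Λ : Set X} (B : RBuilding cs X Λ)

theorem exists_word_chart (hv : cs.Regular v) {a d : ModelSpace n → X} (ha : a ∈ B.charts)
    (hd : d ∈ B.charts) :
    ∃ k ∈ B.charts, ParOn (cs.chamber v) k a ∧ ∃ l, cs.IsWord v l ∧ ∃ u ∈ cs.Wbar,
      ∀ h, ParOn (cs.chamber v) h (k ∘ l.prod) → ParOn (cs.chamber v) (h ∘ u) d := by
  obtain ⟨k, hk, w, hw, h1, h2⟩ := B.exists_parOn_parOn hv ha hd
  obtain ⟨l, hl, -, u, hu, rfl, hC⟩ := exists_word hv hw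
  refine ⟨k, hk, h1, l, hl, u, hu, fun h hh => (hh.comp hu fun p hp => ?_).trans h2⟩
  rw [← hC]
  exact (map_mem_chamber_iff hu p).mpr hp

theorem exists_finite_cover_of_word (hv : cs.Regular v)
    {l : List (ModelSpace n ≃ᵢ ModelSpace n)} (hl : cs.IsWord v l) {k a : ModelSpace n → X}
    (hk : k ∈ B.charts) (ha : a ∈ B.charts) (hka : ParOn (cs.chamber v) k a) :
    ∃ H : Set (ModelSpace n → X), H.Finite ∧
      (∀ h ∈ H, h ∈ B.charts ∧ ParOn (cs.chamber v) h (k ∘ l.prod)) ∧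
      ∀ z, ∃ h ∈ H, a z ∈ range h := by
  induction l generalizing k a with
  | nil =>
    exact ⟨{a}, finite_singleton a, by rintro _ rfl; exact ⟨ha, hka.symm⟩,
      fun z => ⟨a, rfl, mem_range_self z⟩⟩
  | cons s l ih =>
    obtain ⟨⟨β, hs⟩, hl⟩ := isWord_cons.mp hl
    obtain ⟨b, hb, c, hc, κ, hbk, hck, hb', hc'⟩ := B.exists_halves hv hs hk ha hka
    obtain ⟨H₁, hf₁, hp₁, hz₁⟩ := ih hl (B.comp_mem hk hs.mem) hb hbk.symm
    obtain ⟨H₂, hf₂, hp₂, hz₂⟩ := ih hl (B.comp_mem hk hs.mem) hc hck.symm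
    refine ⟨H₁ ∪ H₂, hf₁.union hf₂, ?_, fun z => ?_⟩
    · rintro h (hh | hh)
      exacts [hp₁ h hh, hp₂ h hh]
    · rcases le_total κ ⟪β, z⟫ with hz | hz
      · obtain ⟨y, hy⟩ := hb' z hz
        obtain ⟨h, hh, hr⟩ := hz₁ y
        exact ⟨h, Or.inl hh, hy ▸ hr⟩
      · obtain ⟨y, hy⟩ := hc' z hz
        obtain ⟨h, hh, hr⟩ := hz₂ y
        exact ⟨h, Or.inr hh, hy ▸ hr⟩

/-- An apartment is covered by finitely many apartments containing a given chamber at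
infinity. -/
theorem exists_finite_cover (hv : cs.Regular v) {a d : ModelSpace n → X} (ha : a ∈ B.charts)
    (hd : d ∈ B.charts) :
    ∃ H : Set (ModelSpace n → X), H.Finite ∧
      (∀ h ∈ H, h ∈ B.charts ∧ ParOn (cs.chamber v) h d) ∧ ∀ z, ∃ h ∈ H, a z ∈ range h := by
  obtain ⟨k, hk, hka, l, hl, u, hu, hpar⟩ := B.exists_word_chart hv ha hd
  obtain ⟨H, hf, hH, hz⟩ := B.exists_finite_cover_of_word hv hl hk ha hka
  refine ⟨(fun h => h ∘ ⇑u) '' H, hf.image _, ?_, fun z => ?_⟩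
  · rintro _ ⟨h, hh, rfl⟩
    exact ⟨B.comp_mem (hH h hh).1 hu, hpar h (hH h hh).2⟩
  · obtain ⟨h, hh, hr⟩ := hz z
    exact ⟨_, mem_image_of_mem _ hh, by rwa [u.surjective.range_comp]⟩

theorem exists_germ_of_word (hv : cs.Regular v)
    {l : List (ModelSpace n ≃ᵢ ModelSpace n)} (hl : cs.IsWord v l) {k a : ModelSpace n → X}
    (hk : k ∈ B.charts) (ha : a ∈ B.charts) (hka : ParOn (cs.chamber v) k a)
    (x : ModelSpace n) {u : ModelSpace n ≃ᵢ ModelSpace n} (hu : u ∈ cs.Wbar) :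
    ∃ h ∈ B.charts, ParOn (cs.chamber v) h (k ∘ l.prod) ∧ ∃ ε > 0, ∀ y ∈ cs.chamber v,
      ‖y‖ < ε → a (x + u y) ∈ range h := by
  induction l generalizing k a x u with
  | nil => exact ⟨a, ha, hka.symm, 1, one_pos, fun y _ _ => mem_range_self _⟩
  | cons s l ih =>
    obtain ⟨⟨β, hs⟩, hl⟩ := isWord_cons.mp hl
    obtain ⟨b, hb, c, hc, κ, hbk, hck, hb', hc'⟩ := B.exists_halves hv hs hk ha hka
    have key : ∀ b ∈ B.charts, ParOn (cs.chamber v) b (k ∘ s) →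
        (∃ δ > 0, ∀ y ∈ cs.chamber v, ‖y‖ < δ → a (x + u y) ∈ range b) →
        ∃ h ∈ B.charts, ParOn (cs.chamber v) h (k ∘ (s :: l).prod) ∧ ∃ ε > 0,
          ∀ y ∈ cs.chamber v, ‖y‖ < ε → a (x + u y) ∈ range h := by
      rintro b hb hbk ⟨δ, hδ, hab⟩
      obtain ⟨u', hu', e, hue⟩ := B.exists_transition ha hb
      obtain ⟨h, hh, hpar, ε, hε, hbh⟩ := ih hl (B.comp_mem hk hs.mem) hb hbk.symm (u' x + e)
        (mul_mem hu' hu)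
      refine ⟨h, hh, hpar, min δ ε, lt_min hδ hε, fun y hy hyn => ?_⟩
      rw [hue _ (hab y hy (hyn.trans_le (min_le_left _ _))), Wbar_map_add hu', add_right_comm]
      exact hbh y hy (hyn.trans_le (min_le_right _ _))
    have hβ := norm_of_mem_roots hs.root
    have hbound : ∀ y, |⟪β, u y⟫| ≤ ‖y‖ := fun y => by
      have := abs_real_inner_le_norm β (u y)
      rwa [hβ, one_mul, Wbar_norm_map hu] at this
    have hinner : ∀ y, ⟪β, x + u y⟫ = ⟪β, x⟫ + ⟪u⁻¹ β, y⟫ := fun y => by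
      rw [inner_add_right, Wbar_inner_inv_left hu]
    rcases lt_trichotomy κ ⟪β, x⟫ with hlt | heq | hlt
    · refine key b hb hbk ⟨⟪β, x⟫ - κ, sub_pos.mpr hlt, fun y _ hyn => hb' _ ?_⟩
      rw [inner_add_right]
      linarith [neg_abs_le ⟪β, u y⟫, hbound y]
    · have hr := map_mem_roots hs.root (inv_mem hu)
      rcases hv.pos_or_neg_pos hr with hp | hp
      · refine key b hb hbk ⟨1, one_pos, fun y hy _ => hb' _ ?_⟩
        rw [hinner, heq]
        linarith [hy _ hr hp]
      · refine key c hc hck ⟨1, one_pos, fun y hy _ => hc' _ ?_⟩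
        have := hy _ (neg_mem_roots hr) hp
        rw [inner_neg_left] at this
        rw [hinner, heq]
        linarith
    · refine key c hc hck ⟨κ - ⟪β, x⟫, sub_pos.mpr hlt, fun y _ hyn => hc' _ ?_⟩
      rw [inner_add_right]
      linarith [le_abs_self ⟪β, u y⟫, hbound y]

/-- The germ of a sector and a chamber at infinity lie in a common apartment. -/
theorem exists_germ_chart (hv : cs.Regular v) {a d : ModelSpace n → X} (ha : a ∈ B.charts)
    (hd : d ∈ B.charts) :
    ∃ h ∈ B.charts, ParOn (cs.chamber v) h d ∧ h 0 = a 0 ∧ ∃ u ∈ cs.Wbar, ∃ ε > 0,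
      ∀ y ∈ cs.chamber v, ‖y‖ < ε → a y = h (u y) := by
  obtain ⟨k, hk, hka, l, hl, u, hu, hpar⟩ := B.exists_word_chart hv ha hd
  obtain ⟨h, hh, hp, ε, hε, hr⟩ := B.exists_germ_of_word hv hl hk ha hka 0 (one_mem _)
  have hr' : ∀ y ∈ cs.chamber v, ‖y‖ < ε → a y ∈ range (h ∘ ⇑u) := fun y hy hyn => by
    rw [u.surjective.range_comp]
    simpa using hr y hy hyn
  obtain ⟨u', hu', e, hue⟩ := B.exists_transition ha (B.comp_mem hh hu)
  have hpar' : ParOn (cs.chamber v) (fun z => (h ∘ u) (z + e)) (h ∘ u) :=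
    parOn_of_eqOn (x := 0) (y := e) (B.isom _ (B.translate_mem (B.comp_mem hh hu) e))
      (B.isom _ (B.comp_mem hh hu)) smul_mem_of_mem_chamber fun c _ => by
        simp only [zero_add, add_comm c e]
  refine ⟨_, B.translate_mem (B.comp_mem hh hu) e, hpar'.trans (hpar h hp), ?_, u', hu', ε, hε,
    fun y hy hyn => hue y (hr' y hy hyn)⟩
  have := hue 0 (hr' 0 zero_mem_chamber (by simpa using hε))
  rw [Wbar_map_zero hu'] at this
  exact this.symm

/-- A point and a chamber at infinity lie in a common apartment. -/
theorem exists_chart_at (hv : cs.Regular v) {d : ModelSpace n → X} (hd : d ∈ B.charts) {x : X}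
    (hx : x ∈ Λ) : ∃ h ∈ B.charts, ParOn (cs.chamber v) h d ∧ h 0 = x := by
  obtain ⟨a, ha, ⟨y, rfl⟩, -⟩ := B.A3 x hx x hx
  obtain ⟨h, hh, hp, h0, -⟩ := B.exists_germ_chart hv (B.translate_mem ha y) hd
  exact ⟨h, hh, hp, by rw [h0, zero_add]⟩

end RBuilding

/-- A transitive relation which holds on each member of a finite closed cover of an interval
holds between the end points. -/
theorem rel_of_finite_closed_cover {ι : Type*} [DecidableEq ι] {K : ι → Set ℝ} {T : ℝ → ℝ → Prop}
    (htrans : ∀ a b c, T a b → T b c → T a c) (F : Finset ι) (hK : ∀ i ∈ F, IsClosed (K i))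
    {s t : ℝ} (hst : s ≤ t) (hcov : Icc s t ⊆ ⋃ i ∈ F, K i)
    (hT : ∀ i ∈ F, ∀ a b, s ≤ a → a ≤ b → b ≤ t → a ∈ K i → b ∈ K i → T a b) : T s t := by
  induction F using Finset.strongInduction generalizing s with
  | _ F ih =>
    obtain ⟨i, hi, hsi⟩ := mem_iUnion₂.mp (hcov (left_mem_Icc.mpr hst))
    have hclosed : IsClosed (K i ∩ Icc s t) := (hK i hi).inter isClosed_Icc
    have hbdd : BddAbove (K i ∩ Icc s t) := ⟨t, fun x hx => hx.2.2⟩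
    obtain ⟨hmK, hsm, hmt⟩ := hclosed.csSup_mem ⟨s, hsi, left_mem_Icc.mpr hst⟩ hbdd
    set m := sSup (K i ∩ Icc s t) with hm
    have h1 : T s m := hT i hi s m le_rfl hsm hmt hsi hmK
    rcases hmt.eq_or_lt with heq | hlt
    · exact heq ▸ h1
    refine htrans _ _ _ h1 (ih (F.erase i) (Finset.erase_ssubset hi)
      (fun j hj => hK j (Finset.mem_of_mem_erase hj)) hmt ?_ fun j hj a b ha hab hb =>
        hT j (Finset.mem_of_mem_erase hj) a b (hsm.trans ha) hab hb)
    rw [← closure_Ioc hlt.ne]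
    refine closure_minimal (fun x hx => ?_) (isClosed_biUnion_finset fun j hj =>
      hK j (Finset.mem_of_mem_erase hj))
    obtain ⟨j, hj, hxj⟩ := mem_iUnion₂.mp (hcov ⟨hsm.trans hx.1.le, hx.2⟩)
    refine mem_iUnion₂.mpr ⟨j, Finset.mem_erase.mpr ⟨?_, hj⟩, hxj⟩
    rintro rfl
    exact absurd (le_csSup hbdd ⟨hxj, hsm.trans hx.1.le, hx.2⟩) (not_le.mpr hx.1)

theorem SphericalCoxeterSystem.exists_ball_subset_chamber {n : ℕ} {cs : SphericalCoxeterSystem n}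
    {v p : ModelSpace n} (hp : ∀ α ∈ cs.roots, 0 < ⟪α, v⟫ → 0 < ⟪α, p⟫) :
    ∃ ρ > 0, ∀ y, ‖y‖ < ρ → p + y ∈ cs.chamber v := by
  have : ∀ᶠ y in nhds (0 : ModelSpace n), ∀ α ∈ cs.roots, 0 < ⟪α, v⟫ → 0 ≤ ⟪α, p + y⟫ := by
    rw [Filter.eventually_all_finite cs.finite_roots]
    intro α hα
    by_cases hv : 0 < ⟪α, v⟫
    · have hc : Continuous fun y : ModelSpace n => ⟪α, p + y⟫ := by fun_prop
      have := (hc.tendsto 0).eventually_const_le (u := 0) (by simpa using hp α hα hv)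
      filter_upwards [this] with y hy _ using hy
    · exact Filter.Eventually.of_forall fun y h => absurd h hv
  obtain ⟨ρ, hρ, h⟩ := Metric.eventually_nhds_iff.mp this
  exact ⟨ρ, hρ, fun y hy => h (by rwa [dist_zero_right])⟩

namespace RBuilding

variable {n : ℕ} {cs : SphericalCoxeterSystem n} {v : ModelSpace n} {X : Type*} [MetricSpace X]
  {Λ Λ' : Set X} (B : RBuilding cs X Λ) (B' : RBuilding cs X Λ')

/-- Transport of a property of sectors in a fixed direction along a segment. -/
theorem exists_of_transport (hv : cs.Regular v) {a d : ModelSpace n → X} (ha : a ∈ B.charts)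
    (hd : d ∈ B.charts) (x q : ModelSpace n) (P : ℝ → (ModelSpace n → X) → Prop)
    (hstep : ∀ s t, 0 ≤ s → s ≤ t → t ≤ 1 → ∀ f f' : ModelSpace n → X, f ∈ B.charts →
      f' ∈ B.charts → f' 0 = a (x + t • q) → ∀ ζ, ‖ζ‖ = (t - s) * ‖q‖ →
        (∀ c ∈ cs.chamber v, f c = f' (ζ + c)) → P s f → P t f')
    {f : ModelSpace n → X} (hf : f ∈ B.charts) (hfd : ParOn (cs.chamber v) f d) (hf0 : f 0 = a x)
    (hP : P 0 f) :
    ∃ f' ∈ B.charts, ParOn (cs.chamber v) f' d ∧ f' 0 = a (x + q) ∧ P 1 f' := by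
  classical
  obtain ⟨H, hfin, hH, hz⟩ := B.exists_finite_cover hv ha hd
  have key := rel_of_finite_closed_cover (K := fun h => {t : ℝ | a (x + t • q) ∈ range h})
    (T := fun s t => ∀ f ∈ B.charts, ParOn (cs.chamber v) f d → f 0 = a (x + s • q) → P s f →
      ∃ f' ∈ B.charts, ParOn (cs.chamber v) f' d ∧ f' 0 = a (x + t • q) ∧ P t f')
    (fun r s t h1 h2 f hf hfd hf0 hP => by
      obtain ⟨f', hf', hfd', hf0', hP'⟩ := h1 f hf hfd hf0 hP
      exact h2 f' hf' hfd' hf0' hP') hfin.toFinset (s := 0) (t := 1) ?_ zero_le_one ?_ ?_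
  · obtain ⟨f', hf', hfd', hf0', hP'⟩ := key f hf hfd (by simpa using hf0) hP
    exact ⟨f', hf', hfd', by simpa using hf0', hP'⟩
  · intro h hh
    exact (B.A2 a ha h (hH h (hfin.mem_toFinset.mp hh)).1).1.preimage
      (f := fun t : ℝ => x + t • q) (by fun_prop)
  · intro t _
    obtain ⟨h, hh, hr⟩ := hz (x + t • q)
    exact mem_iUnion₂.mpr ⟨h, hfin.mem_toFinset.mpr hh, hr⟩
  · rintro h hh s t hs hst ht ⟨zs, hzs⟩ ⟨zt, hzt⟩ f hf hfd hf0 hP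
    obtain ⟨hh, hhd⟩ := hH h (hfin.mem_toFinset.mp hh)
    have htr := B.translate_mem hh zt
    have hpar : ParOn (cs.chamber v) (fun y => h (y + zt)) h :=
      parOn_of_eqOn (x := 0) (y := zt) (B.isom _ htr) (B.isom h hh) smul_mem_of_mem_chamber
        fun c _ => by simp only [zero_add, add_comm c zt]
    have h0 : (fun y => h (y + zt)) 0 = a (x + t • q) := by
      simp only [zero_add, hzt]
    refine ⟨_, htr, hpar.trans hhd, h0, hstep s t hs hst ht f _ hf htr h0 (zs - zt) ?_ ?_ hP⟩
    · rw [← dist_eq_norm, ← (B.isom h hh).dist_eq, hzs, hzt, (B.isom a ha).dist_eq,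
        dist_add_left, dist_eq_norm, ← sub_smul, norm_smul, Real.norm_eq_abs, abs_sub_comm,
        abs_of_nonneg (sub_nonneg.mpr hst)]
    · intro c hc
      have := B.eqOn_chamber_of_parOn hv hf hh (hfd.trans hhd.symm) (x := 0) (y := zs)
        (by rw [hf0, hzs]) c hc
      rw [zero_add] at this
      rw [this]
      congr 1
      abel

theorem mem_of_mem_closure (hv : cs.Regular v) (hΛ : Λ ⊆ Λ') (hF : B.charts ⊆ B'.charts)
    {e f : ModelSpace n → X} (he : e ∈ B.charts) (hf : f ∈ B'.charts)
    (hpar : ParOn (cs.chamber v) f e) (h0 : f 0 ∈ closure Λ) {p : ModelSpace n}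
    (hp : ∀ α ∈ cs.roots, 0 < ⟪α, v⟫ → 0 < ⟪α, p⟫) : f p ∈ Λ := by
  obtain ⟨ρ, hρ, hball⟩ := exists_ball_subset_chamber hp
  obtain ⟨β, hβ, hdist⟩ := Metric.mem_closure_iff.mp h0 ρ hρ
  obtain ⟨a, ha, ⟨x, hx⟩, ⟨y, hy⟩⟩ := B'.A3 (f 0) (B'.into f hf (mem_range_self 0)) β (hΛ hβ)
  have hq : ‖y - x‖ < ρ := by
    rwa [← dist_eq_norm, dist_comm, ← (B'.isom a ha).dist_eq, hx, hy]
  obtain ⟨f', hf', hfd', h0', b, hb, hfb⟩ := B'.exists_of_transport hv ha hf x (y - x)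
    (fun t g => ∃ b, ‖b‖ ≤ t * ‖y - x‖ ∧ g (p + b) = f p)
    (fun s t hs hst ht g g' _ _ _ ζ hζ hgg => by
      rintro ⟨b, hb, hgb⟩
      refine ⟨ζ + b, ?_, ?_⟩
      · refine (norm_add_le _ _).trans ?_
        rw [hζ]
        linarith
      · rw [← hgb, hgg _ (hball b (hb.trans_lt (lt_of_le_of_lt ?_ hq)))]
        · congr 1
          abel
        · exact mul_le_of_le_one_left (norm_nonneg _) (hst.trans ht))
    hf (ParOn.refl _ f) hx.symm ⟨0, by simp, by simp⟩
  rw [add_sub_cancel, hy] at h0'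
  rw [one_mul] at hb
  obtain ⟨h, hh, hhe, hh0⟩ := B.exists_chart_at hv he hβ
  have := B'.eqOn_chamber_of_parOn hv hf' (hF hh) (hfd'.trans (hpar.trans hhe.symm))
    (x := 0) (y := 0) (by rw [h0', hh0]) (p + b) (hball b (hb.trans_lt hq))
  rw [zero_add, hfb] at this
  rw [this]
  exact B.into h hh (mem_range_self _)

/-- Straight extension of a sector backwards along the central ray of a sector. -/
theorem exists_backward_extension (hv : cs.Regular v) {a d : ModelSpace n → X}
    (ha : a ∈ B.charts) (hd : d ∈ B.charts) {z : ModelSpace n} (hz : z ∈ cs.chamber v)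
    {ε : ℝ} (hε : 0 < ε) (h0 : d 0 = a z) (h1 : d (ε • z) = a ((1 + ε) • z)) :
    ∃ f ∈ B.charts, ParOn (cs.chamber v) f d ∧ f 0 = a 0 ∧
      f ((1 + ε) • z) = a ((1 + ε) • z) := by
  obtain ⟨f, hf, hfd, hf0, hP⟩ := B.exists_of_transport hv ha hd z (-z)
    (fun t g => g ((t + ε) • z) = a ((1 + ε) • z))
    (fun s t hs hst ht g g' hg hg' hg0 ζ hζ hgg hP => by
      have hmem : (s + ε) • z ∈ cs.chamber v := smul_mem_chamber hz (by linarith)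
      have h2 : g' (ζ + (s + ε) • z) = a ((1 + ε) • z) := by rw [← hgg _ hmem, hP]
      have hnorm : ‖ζ + (s + ε) • z‖ = (t + ε) * ‖z‖ := by
        rw [← dist_zero_left, ← (B.isom g' hg').dist_eq, h2, hg0, (B.isom a ha).dist_eq,
          dist_comm, dist_eq_norm]
        have : (1 + ε) • z - (z + t • -z) = (t + ε) • z := by module
        rw [this, norm_smul, Real.norm_of_nonneg (by linarith)]
      rw [norm_neg] at hζ
      have hpos : (0 : ℝ) < s + ε := by linarith
      have hs' : ‖(s + ε) • z‖ = (s + ε) * ‖z‖ := by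
        rw [norm_smul, Real.norm_of_nonneg hpos.le]
      have hray : SameRay ℝ ζ ((s + ε) • z) := sameRay_iff_norm_add.mpr (by
        rw [hnorm, hζ, hs']; ring)
      have hζz : ζ = (t - s) • z := by
        have h3 := hray.norm_smul_eq
        rw [hs', hζ] at h3
        rcases eq_or_ne z 0 with rfl | hz0
        · rw [norm_zero, mul_zero, norm_eq_zero] at hζ
          rw [hζ, smul_zero]
        · have hzn : (s + ε) * ‖z‖ ≠ 0 := mul_ne_zero hpos.ne' (norm_ne_zero_iff.mpr hz0)
          refine smul_right_injective _ hzn ?_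
          simp only
          rw [← h3]
          module
      rw [← h2, hζz]
      congr 1
      module)
    hd (ParOn.refl _ d) h0 (by rw [zero_add, h1])
  exact ⟨f, hf, hfd, by rw [hf0, add_neg_cancel], hP⟩

end RBuilding

namespace SphericalCoxeterSystem

variable {n : ℕ} {cs : SphericalCoxeterSystem n} {v : ModelSpace n}

theorem exists_pos_smul_norm_lt (p : ModelSpace n) {ε : ℝ} (hε : 0 < ε) :
    ∃ t : ℝ, 0 < t ∧ t ≤ 1 ∧ ‖t • p‖ < ε := by
  have hp : 0 < ‖p‖ + 1 := by positivity
  refine ⟨min 1 (ε / (‖p‖ + 1)), by positivity, min_le_left _ _, ?_⟩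
  rw [norm_smul, Real.norm_of_nonneg (by positivity)]
  calc min 1 (ε / (‖p‖ + 1)) * ‖p‖ ≤ ε / (‖p‖ + 1) * ‖p‖ := by gcongr; exact min_le_right _ _
    _ < ε / (‖p‖ + 1) * (‖p‖ + 1) := by gcongr; linarith
    _ = ε := div_mul_cancel₀ _ hp.ne'

theorem isModelSector_chamber (hv : cs.Regular v) : cs.IsModelSector 0 (cs.chamber v) :=
  isModelSector_iff.mpr ⟨v, hv, by simp⟩

end SphericalCoxeterSystem

theorem Par.refl {X : Type*} [MetricSpace X] (S : Set X) : Par S S := by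
  change Metric.hausdorffEDist S S ≠ ⊤
  rw [Metric.hausdorffEDist_self]
  exact ENNReal.zero_ne_top

namespace RBuilding

variable {n : ℕ} {cs : SphericalCoxeterSystem n} {v : ModelSpace n} {X : Type*} [MetricSpace X]
  {Λ : Set X} (B : RBuilding cs X Λ)

theorem eq_image_of_par (hv : cs.Regular v) {f : ModelSpace n → X} (hf : f ∈ B.charts)
    {F : Set X} (hF : IsSectorAt cs B.charts (f 0) F) (h : Par (f '' cs.chamber v) F) :
    F = f '' cs.chamber v := by
  obtain ⟨t, ht, ht0, rfl⟩ := (B.isSectorAt_iff hv).mp hF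
  obtain ⟨w, hw, hC, hpar⟩ := B.exists_parOn_of_par hv hf ht h
  have heq := B.eqOn_chamber_of_parOn hv hf (B.comp_mem ht hw) hpar (x := 0) (y := 0) (by
    rw [Function.comp_apply, Wbar_map_zero hw, ht0])
  have : f '' cs.chamber v = (t ∘ w) '' cs.chamber v := image_congr fun c hc => by
    have := heq c hc
    rwa [zero_add] at this
  rw [this, image_comp, image_chamber hw, hC]

theorem exists_linear_transition {f g : ModelSpace n → X} (hf : f ∈ B.charts)
    (hg : g ∈ B.charts) (h0 : f 0 = g 0) :
    ∃ u ∈ cs.Wbar, ∀ x, f x ∈ range g → f x = g (u x) := by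
  obtain ⟨u, hu, b, hub⟩ := B.exists_transition hf hg
  have := hub 0 ⟨0, h0.symm⟩
  rw [Wbar_map_zero hu, zero_add, h0] at this
  obtain rfl := (B.isom g hg).injective this
  exact ⟨u, hu, fun x hx => by rw [hub x hx, add_zero]⟩

/-- Charts agreeing on the germ of a sector agree wherever their images meet. -/
theorem eq_of_eqOn_germ {f g : ModelSpace n → X} (hf : f ∈ B.charts)
    (hg : g ∈ B.charts) {ε : ℝ} (hε : 0 < ε)
    (h : ∀ y ∈ cs.chamber v, ‖y‖ < ε → f y = g y) {x : ModelSpace n} (hx : f x ∈ range g) :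
    f x = g x := by
  obtain ⟨u, hu, huf⟩ := B.exists_linear_transition hf hg
    (h 0 zero_mem_chamber (by rwa [norm_zero]))
  have : u = 1 := eq_one_of_fix_chamber (v := v) hu fun c hc => by
    obtain ⟨t, ht, -, htc⟩ := exists_pos_smul_norm_lt c hε
    have h1 := h _ (smul_mem_chamber hc ht.le) htc
    have h2 := huf _ ⟨_, h1.symm⟩
    rw [h1] at h2
    have h3 := (B.isom g hg).injective h2
    rw [Wbar_map_smul hu] at h3
    exact (smul_right_injective _ ht.ne' h3).symm
  rw [huf x hx, this, IsometryEquiv.coe_one, id]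

theorem exists_of_locCoin (hv : cs.Regular v) {f g : ModelSpace n → X} (hf : f ∈ B.charts)
    (hg : g ∈ B.charts) (h0 : f 0 = g 0)
    (h : LocCoin (g 0) (g '' cs.chamber v) (f '' cs.chamber v)) :
    ∃ u ∈ cs.Wbar, cs.chamber (u v) = cs.chamber v ∧ ∃ ε > 0, ∀ y ∈ cs.chamber v,
      ‖y‖ < ε → f y = g (u y) := by
  obtain ⟨u, hu, huf⟩ := B.exists_linear_transition hf hg h0
  obtain ⟨ε, hε, hball⟩ := Metric.mem_nhdsWithin_iff.mp h.2
  have hmem : ∀ y ∈ cs.chamber v, ‖y‖ < ε → f y = g (u y) ∧ u y ∈ cs.chamber v :=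
    fun y hy hyn => by
      obtain ⟨⟨c, hc, hcy⟩, -⟩ := hball (a := f y) ⟨by
        rw [Metric.mem_ball, ← h0, (B.isom f hf).dist_eq, dist_zero_right]
        exact hyn, mem_image_of_mem f hy⟩
      have h1 := huf y ⟨c, hcy⟩
      refine ⟨h1, ?_⟩
      rw [← hcy] at h1
      exact (B.isom g hg).injective h1 ▸ hc
  refine ⟨u, hu, ?_, ε, hε, fun y hy hyn => (hmem y hy hyn).1⟩
  obtain ⟨t, ht, -, htv⟩ := exists_pos_smul_norm_lt v hε
  have h1 := (hmem _ (smul_mem_chamber self_mem_chamber ht.le) htv).2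
  rw [Wbar_map_smul hu] at h1
  have h2 := smul_mem_chamber h1 (inv_nonneg.mpr ht.le)
  rw [inv_smul_smul₀ ht.ne'] at h2
  exact (chamber_eq_of_mem hv (hv.map hu) h2).symm

theorem locCoin_of_eqOn {f g : ModelSpace n → X} (hf : f ∈ B.charts) (hg : g ∈ B.charts)
    (h0 : f 0 = g 0) {u : ModelSpace n ≃ᵢ ModelSpace n} (hu : u ∈ cs.Wbar)
    (hC : cs.chamber (u v) = cs.chamber v) {ε : ℝ} (hε : 0 < ε)
    (h : ∀ y ∈ cs.chamber v, ‖y‖ < ε → f y = g (u y)) :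
    LocCoin (f 0) (f '' cs.chamber v) (g '' cs.chamber v) := by
  constructor
  · refine Metric.mem_nhdsWithin_iff.mpr ⟨ε, hε, ?_⟩
    rintro _ ⟨hb, y, hy, rfl⟩
    rw [Metric.mem_ball, (B.isom f hf).dist_eq, dist_zero_right] at hb
    refine ⟨mem_image_of_mem f hy, u y, ?_, (h y hy hb).symm⟩
    rw [← hC]
    exact (map_mem_chamber_iff hu y).mpr hy
  · refine Metric.mem_nhdsWithin_iff.mpr ⟨ε, hε, ?_⟩
    rintro _ ⟨hb, y, hy, rfl⟩
    rw [Metric.mem_ball, h0, (B.isom g hg).dist_eq, dist_zero_right] at hb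
    refine ⟨⟨u⁻¹ y, ?_, ?_⟩, mem_image_of_mem g hy⟩
    · rw [← map_mem_chamber_iff hu, apply_inv_apply, hC]
      exact hy
    · rw [h, apply_inv_apply]
      · rw [← map_mem_chamber_iff hu, apply_inv_apply, hC]
        exact hy
      · rwa [Wbar_norm_map (inv_mem hu)]

theorem exists_chart_of_locCoin (hv : cs.Regular v) {f : ModelSpace n → X}
    (hf : f ∈ B.charts) {F : Set X} (hF : IsSectorAt cs B.charts (f 0) F)
    (h : LocCoin (f 0) F (f '' cs.chamber v)) :
    ∃ g ∈ B.charts, g 0 = f 0 ∧ F = g '' cs.chamber v ∧ ∃ ε > 0, ∀ y ∈ cs.chamber v,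
      ‖y‖ < ε → g y = f y := by
  obtain ⟨g, hg, hg0, rfl⟩ := (B.isSectorAt_iff hv).mp hF
  obtain ⟨u, hu, hC, ε, hε, h⟩ := B.exists_of_locCoin hv hf hg hg0.symm (by rwa [hg0])
  refine ⟨g ∘ u, B.comp_mem hg hu, ?_, ?_, ε, hε, fun y hy hyn => (h y hy hyn).symm⟩
  · rw [Function.comp_apply, Wbar_map_zero hu, hg0]
  · rw [image_comp, image_chamber hu, hC]

/-- Charts adapted to a pair of sectors whose germs have Weyl distance `w`. -/
theorem exists_charts_of_germWeylDist {α : X} {S S' : Set X}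
    (hS : IsSectorAt cs B.charts α S) (hS' : IsSectorAt cs B.charts α S')
    {w : ModelSpace n ≃ᵢ ModelSpace n} (h : GermWeylDist cs B.charts α S S' w) :
    ∃ v, cs.Regular v ∧ w ∈ cs.Wbar ∧ ∃ f₁ ∈ B.charts, ∃ f₂ ∈ B.charts, ∃ f ∈ B.charts,
      f₁ 0 = α ∧ f₂ 0 = α ∧ f 0 = α ∧ S = f₁ '' cs.chamber v ∧ S' = f₂ '' cs.chamber v ∧
      ∃ ε > 0, ∀ y ∈ cs.chamber v, ‖y‖ < ε → f₁ y = f y ∧ f₂ y = f (w y) := by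
  obtain ⟨f, hf, T, T', hT, hT', hTf, -, hST, hST', hw, s, s', hs, -, hsT, hsT', rfl⟩ := h
  obtain ⟨v, hv, rfl⟩ := isModelSector_iff.mp hs
  simp only [sub_zero, ofPred_mem_eq] at hsT hsT'
  obtain ⟨x, hx⟩ : α ∈ range f := by
    obtain ⟨t, -, ht0, rfl⟩ := (B.isSectorAt_iff hv).mp hT
    exact hTf ⟨0, zero_mem_chamber, ht0⟩
  have hg := B.translate_mem hf x
  have hpar : ∀ v', ParOn (cs.chamber v') (fun y => f (y + x)) f := fun v' =>
    parOn_of_eqOn (x := 0) (y := x) (B.isom _ hg) (B.isom f hf) smul_mem_of_mem_chamber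
      fun c _ => by simp only [zero_add, add_comm c x]
  have hg0 : (fun y => f (y + x)) 0 = α := by simp only [zero_add, hx]
  set g : ModelSpace n → X := fun y => f (y + x)
  have hvw := hv.map hw
  rw [image_chamber hw] at hsT'
  subst hg0
  obtain rfl := B.eq_image_of_par hv hg hT ((B.par_of_parOn hv hg hf (hpar v)).trans hsT)
  obtain rfl := B.eq_image_of_par hvw hg hT' ((B.par_of_parOn hvw hg hf (hpar _)).trans hsT')
  obtain ⟨f₁, hf₁, h₁, rfl, ε₁, hε₁, he₁⟩ := B.exists_chart_of_locCoin hv hg hS hST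
  obtain ⟨f₂, hf₂, h₂, rfl, ε₂, hε₂, he₂⟩ := B.exists_chart_of_locCoin hvw hg hS' hST'
  refine ⟨v, hv, hw, f₁, hf₁, f₂ ∘ w, B.comp_mem hf₂ hw, g, hg, h₁, ?_, rfl, rfl, ?_,
    min ε₁ ε₂, lt_min hε₁ hε₂, fun y hy hyn => ⟨he₁ y hy (hyn.trans_le (min_le_left _ _)),
      he₂ _ ((map_mem_chamber_iff hw y).mpr hy) ?_⟩⟩
  · rw [Function.comp_apply, Wbar_map_zero hw, h₂]
  · rw [image_comp, image_chamber hw]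
  · rw [Wbar_norm_map hw]
    exact hyn.trans_le (min_le_right _ _)

end RBuilding

namespace RBuilding

variable {n : ℕ} {cs : SphericalCoxeterSystem n} {v : ModelSpace n} {X : Type*} [MetricSpace X]
  {Λ : Set X} (B : RBuilding cs X Λ)

/-- Two sectors with the same base point that share a further interior point in corresponding
position have the same germ. -/
theorem locCoin_of_apply_eq (hv : cs.Regular v) {a b : ModelSpace n → X} (ha : a ∈ B.charts)
    (hb : b ∈ B.charts) (h0 : b 0 = a 0) {r : ℝ} (hr : 0 < r) (hab : b (r • v) = a (r • v)) :
    LocCoin (a 0) (a '' cs.chamber v) (b '' cs.chamber v) := by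
  obtain ⟨u', hu', hab'⟩ := B.exists_linear_transition ha hb h0.symm
  have hfix : u' (r • v) = r • v :=
    (B.isom b hb).injective (by rw [← hab' _ ⟨_, hab⟩, hab])
  rw [Wbar_map_smul hu'] at hfix
  replace hfix := smul_right_injective _ hr.ne' hfix
  obtain ⟨h, hh, hhb, hh0, u, hu, ε, hε, hau⟩ := B.exists_germ_chart hv ha hb
  have hhb' : ∀ y ∈ cs.chamber v, h y = b y := fun y hy => by
    simpa only [zero_add] using
      B.eqOn_chamber_of_parOn hv hh hb hhb (x := 0) (y := 0) (by rw [hh0, h0]) y hy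
  obtain ⟨s, hs, hs1, hsn⟩ := exists_pos_smul_norm_lt (r • v) hε
  have hsv : (s • r • v : ModelSpace n) ∈ cs.chamber v :=
    smul_mem_chamber (smul_mem_chamber self_mem_chamber hr.le) hs.le
  have hmem : a (s • r • v) ∈ range b := by
    have := (B.A2 a ha b hb).2.1 (x := 0) ⟨0, h0⟩ (y := r • v) ⟨_, hab⟩
      (sub_nonneg.mpr hs1) hs.le (sub_add_cancel 1 s)
    rwa [smul_zero, zero_add] at this
  have hus : u (s • r • v) = s • r • v := (B.isom h hh).injective (by
    rw [← hau _ hsv hsn, hab' _ hmem, hhb' _ hsv, Wbar_map_smul hu', Wbar_map_smul hu', hfix])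
  rw [Wbar_map_smul hu, Wbar_map_smul hu] at hus
  have huv : u v = v := smul_right_injective _ hr.ne' (smul_right_injective _ hs.ne' hus)
  have hC : cs.chamber (u v) = cs.chamber v := by rw [huv]
  refine B.locCoin_of_eqOn ha hb h0.symm hu hC hε fun y hy hyn => ?_
  rw [hau y hy hyn, hhb']
  rw [← hC]
  exact (map_mem_chamber_iff hu y).mpr hy

theorem eqOn_germ_of_eqOn_germ {w u : ModelSpace n ≃ᵢ ModelSpace n} {a h k : ModelSpace n → X}
    (hh : h ∈ B.charts) (hk : k ∈ B.charts) {ε ε' : ℝ} (hε : 0 < ε)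
    (hkh : ∀ y ∈ cs.chamber v, ‖y‖ < ε → k y = h y)
    (hak : ∀ y ∈ cs.chamber v, ‖y‖ < ε → a y = k (w y))
    (hah : ∀ y ∈ cs.chamber v, ‖y‖ < ε' → a y = h (u y)) :
    ∀ y ∈ cs.chamber v, ‖y‖ < min ε ε' → a y = h (w y) := fun y hy hyn => by
  have h1 := hak y hy (hyn.trans_le (min_le_left _ _))
  rw [h1]
  exact B.eq_of_eqOn_germ hk hh hε hkh
    ⟨u y, by rw [← h1, hah y hy (hyn.trans_le (min_le_right _ _))]⟩

theorem exists_parOn_of_isSector {Λ' : Set X} (B' : RBuilding cs X Λ') (hv : cs.Regular v)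
    (hF : B.charts ⊆ B'.charts) {f : ModelSpace n → X} (hf : f ∈ B'.charts)
    (h : ∃ T, IsSector cs B.charts T ∧ Par (f '' cs.chamber v) T) :
    ∃ e ∈ B.charts, ParOn (cs.chamber v) f e := by
  obtain ⟨T, hT, hpar⟩ := h
  obtain ⟨e, he, rfl⟩ := (B.isSector_iff hv).mp hT
  obtain ⟨u, hu, -, hfe⟩ := B'.exists_parOn_of_par hv hf (hF he) hpar
  exact ⟨e ∘ u, B.comp_mem he hu, hfe⟩

theorem chamberWeylDist_of_parOn (hv : cs.Regular v) {w : ModelSpace n ≃ᵢ ModelSpace n}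
    (hw : w ∈ cs.Wbar) {a b g : ModelSpace n → X} (ha : a ∈ B.charts) (hb : b ∈ B.charts)
    (hg : g ∈ B.charts) (hga : ParOn (cs.chamber v) g a)
    (hgb : ParOn (cs.chamber v) (g ∘ w) b) :
    ChamberWeylDist cs B.charts (a '' cs.chamber v) (b '' cs.chamber v) w := by
  have hgw := B.comp_mem hg hw
  refine ⟨g, hg, g '' cs.chamber v, (g ∘ w) '' cs.chamber v, (B.isSector_iff hv).mpr ⟨g, hg, rfl⟩,
    (B.isSector_iff hv).mpr ⟨_, hgw, rfl⟩, image_subset_range _ _,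
    (image_subset_range _ _).trans (range_comp_subset_range _ _), B.par_of_parOn hv hg ha hga,
    B.par_of_parOn hv hgw hb hgb, hw, cs.chamber v, w '' cs.chamber v,
    isModelSector_chamber hv, ?_, Par.refl _, ?_, rfl⟩
  · rw [image_chamber hw]
    exact isModelSector_chamber (hv.map hw)
  · rw [image_comp]
    exact Par.refl _

end RBuilding

/-- **Lemma 10.** With `(Λ,F)` contained in a complete ℝ-building
`(Λ',F')` and `α ∈ Λ̄ \ Λ`: if `C_α`, `C'_α` are sectors of `Λ'` based at `α` whose
directions are chambers at infinity of `Λ` and `w` is the Weyl distance between their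
germs, then there is a sector `C''_α` based at `α` with the same germ as `C'_α`, whose
direction is a chamber at infinity of `Λ`, with Weyl distance `w` from `C_∞` to
`C''_∞`. -/
theorem exists_sector_with_weyl_distance
    {n : ℕ} (cs : SphericalCoxeterSystem n) {X : Type*} [MetricSpace X]
    {Λ Λ' : Set X} (B : RBuilding cs X Λ) (B' : RBuilding cs X Λ')
    (hΛ : Λ ⊆ Λ') (hF : B.charts ⊆ B'.charts) (hcomplete : IsComplete Λ')
    (α : X) (hα : α ∈ closure Λ) (hαΛ : α ∉ Λ)
    (Cα C'α : Set X)
    (hCα : IsSectorAt cs B'.charts α Cα)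
    (hC'α : IsSectorAt cs B'.charts α C'α)
    (hCdir : ∃ T, IsSector cs B.charts T ∧ Par Cα T)
    (hC'dir : ∃ T, IsSector cs B.charts T ∧ Par C'α T)
    (w : ModelSpace n ≃ᵢ ModelSpace n)
    (hw : GermWeylDist cs B'.charts α Cα C'α w) :
    ∃ C''α : Set X, IsSectorAt cs B'.charts α C''α ∧
      LocCoin α C'α C''α ∧
      (∃ T, IsSector cs B.charts T ∧ Par C''α T) ∧
      ChamberWeylDist cs B'.charts Cα C''α w := by
  obtain ⟨v, hv, hwW, f₁, hf₁, f₂, hf₂, f, hf, hf₁α, hf₂α, -, rfl, rfl, ε, hε, hgerm⟩ :=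
    B'.exists_charts_of_germWeylDist hCα hC'α hw
  obtain ⟨e₁, he₁, hfe₁⟩ := B.exists_parOn_of_isSector B' hv hF hf₁ hCdir
  obtain ⟨e₂, he₂, hfe₂⟩ := B.exists_parOn_of_isSector B' hv hF hf₂ hC'dir
  obtain ⟨h, hh, hhf, hh0, u₁, -, ε₁, hε₁, hfh⟩ := B'.exists_germ_chart hv hf₂ hf₁
  -- near the base point, both sectors lie in the apartment of `h`
  have hfh' : ∀ y ∈ cs.chamber v, ‖y‖ < min ε ε₁ → f₂ y = h (w y) :=
    B'.eqOn_germ_of_eqOn_germ hh hf hε (fun y hy hyn => by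
      have := B'.eqOn_chamber_of_parOn hv hh hf₁ hhf (x := 0) (y := 0)
        (by rw [hh0, hf₁α, hf₂α]) y hy
      rw [zero_add] at this
      rw [this, (hgerm y hy hyn).1]) (fun y hy hyn => (hgerm y hy hyn).2) hfh
  obtain ⟨η, hη, -, hηn⟩ := exists_pos_smul_norm_lt v (half_pos (lt_min hε hε₁))
  have hzC : (η • v : ModelSpace n) ∈ cs.chamber v := smul_mem_chamber self_mem_chamber hη.le
  have hzΛ : f₂ (η • v) ∈ Λ := B.mem_of_mem_closure B' hv hΛ hF he₂ hf₂ hfe₂ (by rwa [hf₂α])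
    fun β _ hβ => by rw [inner_smul_right]; positivity
  set z : ModelSpace n := η • v with hz
  obtain ⟨g₂, hg₂, hge₂, hg₂0⟩ := B.exists_chart_at hv he₂ hzΛ
  obtain ⟨g₁, hg₁, hge₁, hg₁0, u₂, -, ε₂, hε₂, hgg⟩ := B.exists_germ_chart hv hg₂ he₁
  have hfg₂ : ∀ y ∈ cs.chamber v, f₂ (z + y) = g₂ y := fun y hy => by
    simpa only [zero_add] using B'.eqOn_chamber_of_parOn hv hf₂ (hF hg₂) (hfe₂.trans hge₂.symm)
      (x := z) (y := 0) hg₂0.symm y hy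
  have hδ : 0 < min ε ε₁ / 2 := half_pos (lt_min hε hε₁)
  -- near `f₂ z`, the sector `f₂ z + C` lies in the apartment of `g₁`
  have hfg₁ : ∀ y ∈ cs.chamber v, ‖y‖ < min (min ε ε₁ / 2) ε₂ → f₂ (z + y) = g₁ (w y) :=
    B'.eqOn_germ_of_eqOn_germ (u := u₂) (hF hg₁) (B'.translate_mem hh (w z)) hδ
      (fun y hy _ => by
        have := B'.eqOn_chamber_of_parOn hv hh (hF hg₁)
          ((hhf.trans hfe₁).trans hge₁.symm) (x := w z) (y := 0)
          (by rw [hg₁0, hg₂0, hfh' z hzC (hηn.trans (half_lt_self (lt_min hε hε₁)))]) y hy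
        rwa [zero_add, add_comm] at this)
      (fun y hy hyn => by
        rw [hfh' _ (add_mem_chamber hzC hy) ((norm_add_le _ _).trans_lt (by linarith)),
          Wbar_map_add hwW, add_comm])
      (fun y hy hyn => by rw [hfg₂ y hy, hgg y hy hyn])
  have hd := B.comp_mem hg₁ hwW
  obtain ⟨t, ht, -, htn⟩ := exists_pos_smul_norm_lt z (lt_min hδ hε₂)
  obtain ⟨f', hf', hfd, hf0, hfz⟩ := B'.exists_backward_extension hv hf₂ (hF hd) hzC ht
    (by rw [Function.comp_apply, Wbar_map_zero hwW, hg₁0, hg₂0])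
    (by rw [Function.comp_apply, ← hfg₁ _ (smul_mem_chamber hzC ht.le) htn, add_smul, one_smul])
  rw [hz, smul_smul] at hfz
  refine ⟨f' '' cs.chamber v, (B'.isSectorAt_iff hv).mpr ⟨f', hf', hf0.trans hf₂α, rfl⟩,
    hf₂α ▸ B'.locCoin_of_apply_eq hv hf₂ hf' hf0 (by positivity) hfz,
    ⟨_, (B.isSector_iff hv).mpr ⟨_, hd, rfl⟩, B'.par_of_parOn hv hf' (hF hd) hfd⟩,
    B'.chamberWeylDist_of_parOn hv hwW hf₁ hf' (hF hg₁) (hge₁.trans hfe₁.symm) hfd.symm⟩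
end
end

section
/- (Bruhat–Tits fixed point theorem.) Let (X,d) be a complete CAT(0) metric space and let G be a group of isometries of X such that some G-orbit is a bounded subset of X. Then G fixes some point of X. -/
open Set

noncomputable section

/-- Three reals satisfying the triangle inequalities are the side lengths of a triangle in the
Euclidean plane. -/
lemma exists_comparison_triangle {a b c : ℝ} (ha : 0 ≤ a) (hb : 0 ≤ b) (hc : 0 ≤ c)
    (habc : a ≤ b + c) (hbca : b ≤ c + a) (hcab : c ≤ a + b) :
    ∃ x y z : EuclideanSpace ℝ (Fin 2), dist x y = a ∧ dist y z = b ∧ dist x z = c := by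
  rcases ha.eq_or_lt with rfl | ha
  · obtain rfl : b = c := by linarith
    refine ⟨!₂[0, 0], !₂[0, 0], !₂[b, 0], ?_, ?_, ?_⟩ <;>
      simp [EuclideanSpace.dist_eq, Real.sqrt_sq, hb, Real.dist_eq]
  · obtain ⟨u, hu⟩ : ∃ u : ℝ, 2 * a * u = a ^ 2 + c ^ 2 - b ^ 2 :=
      ⟨(a ^ 2 + c ^ 2 - b ^ 2) / (2 * a), by field_simp⟩
    have huc : u ≤ c := by nlinarith
    have hcu : -c ≤ u := by nlinarith
    have hv : √(c ^ 2 - u ^ 2) ^ 2 = c ^ 2 - u ^ 2 := Real.sq_sqrt (by nlinarith)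
    refine ⟨!₂[0, 0], !₂[a, 0], !₂[u, √(c ^ 2 - u ^ 2)], ?_, ?_, ?_⟩ <;>
      rw [EuclideanSpace.dist_eq, Real.sqrt_eq_iff_mul_self_eq (by positivity) (by positivity)] <;>
      simp only [Fin.sum_univ_two, Real.dist_eq, sq_abs, Matrix.cons_val_zero,
        Matrix.cons_val_one]
    · ring
    · linear_combination hv - hu
    · linear_combination hv

/-- The Bruhat–Tits (CN) inequality. -/
lemma IsCAT0Space.exists_midpoint {Y : Type*} [MetricSpace Y] (hY : IsCAT0Space Y) (x y : Y) :
    ∃ m : Y, ∀ z : Y,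
      dist z m ^ 2 ≤ (dist z x ^ 2 + dist z y ^ 2) / 2 - dist x y ^ 2 / 4 := by
  obtain ⟨S, hS⟩ := hY.1 x y
  obtain ⟨a, b, γ, hab, hx, hy, hγ, rfl⟩ := id hS
  have hmem : (a + b) / 2 ∈ Icc a b := ⟨by linarith, by linarith⟩
  have hxy : dist x y = b - a := by
    rw [← hx, ← hy, hγ a (left_mem_Icc.2 hab) b (right_mem_Icc.2 hab), abs_sub_comm,
      abs_of_nonneg (by linarith)]
  have hxm : dist x (γ ((a + b) / 2)) = (b - a) / 2 := by
    rw [← hx, hγ a (left_mem_Icc.2 hab) _ hmem, abs_sub_comm, abs_of_nonneg (by linarith)]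
    ring
  refine ⟨γ ((a + b) / 2), fun z ↦ ?_⟩
  obtain ⟨x', y', z', hxy', hyz', hxz'⟩ := exists_comparison_triangle
    (dist_nonneg (x := x) (y := y)) (dist_nonneg (x := y) (y := z)) (dist_nonneg (x := x) (y := z))
    (by linarith [dist_triangle x z y, dist_comm y z])
    (by linarith [dist_triangle y x z, dist_comm y x]) (dist_triangle x y z)
  have hle := hY.2 x y z _ hS _ (mem_image_of_mem γ hmem) x' y' z' hxy' hyz' hxz'
    (midpoint ℝ x' y') (midpoint_mem_segment x' y') (by
      rw [dist_left_midpoint, hxy', hxm, hxy, Real.norm_ofNat]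
      ring)
  have hsq : dist z (γ ((a + b) / 2)) ^ 2 ≤ dist z' (midpoint ℝ x' y') ^ 2 := by gcongr
  have hpar := EuclideanGeometry.dist_sq_add_dist_sq_eq_two_mul_dist_midpoint_sq_add_half_dist_sq
    z' x' y'
  rw [dist_comm z' x', dist_comm z' y', hxy', hyz', hxz'] at hpar
  rw [dist_comm z x, dist_comm z y]
  linarith

/-- For a nonempty bounded subset of a complete CAT(0) space there is a radius (the circumradius)
for which exactly one closed ball contains the subset. -/
lemma IsCAT0Space.exists_circumcenter {Y : Type*} [MetricSpace Y] [CompleteSpace Y]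
    (hY : IsCAT0Space Y) {S : Set Y} (hne : S.Nonempty) (hS : Bornology.IsBounded S) :
    ∃ r : ℝ, ∃! c : Y, S ⊆ Metric.closedBall c r := by
  obtain ⟨s₀, hs₀⟩ := hne
  set T : Set ℝ := {t | ∃ x, S ⊆ Metric.closedBall x t}
  have hT : ∀ t ∈ T, 0 ≤ t := fun t ⟨x, hx⟩ ↦ dist_nonneg.trans (hx hs₀)
  have hTne : T.Nonempty := (hS.subset_closedBall s₀).imp fun t ht ↦ ⟨s₀, ht⟩
  set r := sInf T
  have hr : 0 ≤ r := le_csInf hTne hT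
  have hdist : ∀ t x y, S ⊆ Metric.closedBall x t → S ⊆ Metric.closedBall y t →
      dist x y ^ 2 ≤ 4 * (t ^ 2 - r ^ 2) := by
    intro t x y hx hy
    obtain ⟨m, hm⟩ := hY.exists_midpoint x y
    have hsm : ∀ s ∈ S, dist s m ^ 2 ≤ t ^ 2 - dist x y ^ 2 / 4 := fun s hs ↦ by
      have h₁ : dist s x ^ 2 ≤ t ^ 2 := by gcongr; exact hx hs
      have h₂ : dist s y ^ 2 ≤ t ^ 2 := by gcongr; exact hy hs
      linarith [hm s]
    have hnonneg := (sq_nonneg _).trans (hsm s₀ hs₀)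
    have hle : r ≤ √(t ^ 2 - dist x y ^ 2 / 4) :=
      csInf_le ⟨0, hT⟩ ⟨m, fun s hs ↦ Real.le_sqrt_of_sq_le (hsm s hs)⟩
    linarith [(Real.le_sqrt hr hnonneg).1 hle]
  have hex : ∀ n : ℕ, ∃ x, S ⊆ Metric.closedBall x (r + 1 / (n + 1)) := fun n ↦ by
    obtain ⟨t, ⟨x, hx⟩, ht⟩ := exists_lt_of_csInf_lt hTne
      (lt_add_of_pos_right r (Nat.one_div_pos_of_nat (n := n)))
    exact ⟨x, hx.trans (Metric.closedBall_subset_closedBall ht.le)⟩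
  choose x hx using hex
  have hlim : Filter.Tendsto (fun n : ℕ ↦ r + 1 / ((n : ℝ) + 1)) Filter.atTop (nhds r) := by
    simpa using tendsto_one_div_add_atTop_nhds_zero_nat.const_add r
  have hcauchy : CauchySeq x := by
    refine cauchySeq_of_le_tendsto_0' (fun n : ℕ ↦ √(4 * ((r + 1 / (n + 1)) ^ 2 - r ^ 2)))
      (fun n k hnk ↦ Real.le_sqrt_of_sq_le (hdist _ _ _ (hx n) ((hx k).trans ?_))) ?_
    · exact Metric.closedBall_subset_closedBall (by gcongr)
    · convert (((hlim.pow 2).sub_const (r ^ 2)).const_mul 4).sqrt using 2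
      rw [sub_self, mul_zero, Real.sqrt_zero]
  obtain ⟨c, hc⟩ := cauchySeq_tendsto_of_complete hcauchy
  have hcr : S ⊆ Metric.closedBall c r := fun s hs ↦
    le_of_tendsto_of_tendsto' (tendsto_const_nhds.dist hc) hlim fun n ↦ hx n hs
  refine ⟨r, c, hcr, fun c' hc' ↦ ?_⟩
  have := hdist r c' c hc' hcr
  rw [sub_self, mul_zero] at this
  exact dist_eq_zero.1 (pow_eq_zero_iff two_ne_zero |>.1 (this.antisymm (sq_nonneg _)))

/-- **Bruhat–Tits fixed point theorem.** A group of isometries of a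
complete CAT(0) metric space with a bounded orbit fixes a point. -/
theorem bruhatTits_fixedPoint
    {X : Type*} [MetricSpace X] [CompleteSpace X]
    (hX : IsCAT0Space X)
    (G : Subgroup (X ≃ᵢ X))
    (hbounded : ∃ p : X, Bornology.IsBounded {q : X | ∃ g ∈ G, g p = q}) :
    ∃ p : X, ∀ g ∈ G, g p = p := by
  obtain ⟨p, hp⟩ := hbounded
  obtain ⟨r, c, hc, huniq⟩ := hX.exists_circumcenter
    (S := {q | ∃ g ∈ G, g p = q}) ⟨p, 1, G.one_mem, rfl⟩ hp
  refine ⟨c, fun g hg ↦ huniq (g c) ?_⟩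
  rintro _ ⟨h, hh, rfl⟩
  have hmem : (g⁻¹ * h) p ∈ Metric.closedBall c r :=
    hc (mem_ofPred.2 ⟨_, G.mul_mem (G.inv_mem hg) hh, rfl⟩)
  rwa [Metric.mem_closedBall, ← g.dist_eq, ← IsometryEquiv.mul_apply, mul_inv_cancel_left] at hmem
end
end
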